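/- For every α ∈ [−1/4, 1] there exists a constant C > 0, depending only on ν, μ and α, such that for every u₀ in the Schwartz class on ℝ one has ‖D_x^{α} S(t) P^a u₀‖_{L^p_x L^q_t} ≤ C ‖u₀‖_{L²(ℝ)}, where the exponents p, q are determined by 1/p = (1 − α)/5 and 1/q = (4α + 1)/10. (Interpolated smoothing–maximal estimates, Lemma 2.1, estimate (2.4).) -/

import Mathlib

open MeasureTheory Real
open scoped ENNReal NNReal Classical

noncomputable section

/-- Phase function of the linear Benjamin equation: `φ(ξ) = -ν ξ|ξ| + μ ξ³`. -/
def phase (ν μ ξ : ℝ) : ℝ := -ν * ξ * |ξ| + μ * ξ ^ 3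

/-- Derivative of the phase: `φ'(ξ) = -2ν|ξ| + 3μξ²`. -/
def dphase (ν μ ξ : ℝ) : ℝ := -2 * ν * |ξ| + 3 * μ * ξ ^ 2

/-- The frequency threshold `a = 2·max(1, |2ν/(3μ)|)`. -/
def aconst (ν μ : ℝ) : ℝ := 2 * max 1 |2 * ν / (3 * μ)|

/-- Fourier transform in the space variable. -/
def FT (f : ℝ → ℂ) (ξ : ℝ) : ℂ := ∫ x : ℝ, Complex.exp (-(Complex.I * ξ * x)) * f x

/-- Space-time Fourier transform. -/
def FT2 (u : ℝ → ℝ → ℂ) (ξ τ : ℝ) : ℂ :=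
  ∫ x : ℝ, ∫ t : ℝ, Complex.exp (-(Complex.I * (ξ * x + τ * t))) * u x t

/-- Mixed norm `‖f‖_{L^p_x L^q_t}` (with exponents in `ℝ≥0∞`). -/
def mixedLpLq (p q : ℝ≥0∞) (f : ℝ → ℝ → ℂ) : ℝ≥0∞ :=
  if p = ∞ then essSup (fun x => eLpNorm (f x) q volume) volume
  else (∫⁻ x : ℝ, eLpNorm (f x) q volume ^ p.toReal) ^ (1 / p.toReal)

/-- The Bourgain norm `‖u‖_{X_{s,b}}` associated to the Benjamin phase function. -/
def XNorm (ν μ s b : ℝ) (u : ℝ → ℝ → ℂ) : ℝ≥0∞ :=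
  (∫⁻ ξ : ℝ, ∫⁻ τ : ℝ,
      ENNReal.ofReal ((1 + ξ ^ 2) ^ s * (1 + (τ - phase ν μ ξ) ^ 2) ^ b) *
        (‖FT2 u ξ τ‖₊ : ℝ≥0∞) ^ 2) ^ (1 / 2 : ℝ)

/-- The free Benjamin group `S(t)` applied to initial data `u₀`, as a function of `(x,t)`. -/
def Sgrp (ν μ : ℝ) (u₀ : ℝ → ℂ) (x t : ℝ) : ℂ :=
  (2 * π)⁻¹ • ∫ ξ : ℝ, Complex.exp (Complex.I * (ξ * x + phase ν μ ξ * t)) * FT u₀ ξ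

/-- `D_x^α S(t) P^a u₀` : the Benjamin group composed with the Fourier restriction
`P^a` to `{|ξ| ≥ a}` and the derivative operator `D_x^α`. -/
def DSgrpPa (ν μ α : ℝ) (u₀ : ℝ → ℂ) (x t : ℝ) : ℂ :=
  (2 * π)⁻¹ • ∫ ξ : ℝ,
    if aconst ν μ ≤ |ξ| then
      (↑(|ξ| ^ α) : ℂ) * Complex.exp (Complex.I * (ξ * x + phase ν μ ξ * t)) * FT u₀ ξ
    else 0

/-- `D_x^α P^a F` acting in the space variable of a space-time function `F`. -/
def DPa (ν μ α : ℝ) (F : ℝ → ℝ → ℂ) (x t : ℝ) : ℂ :=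
  (2 * π)⁻¹ • ∫ ξ : ℝ,
    if aconst ν μ ≤ |ξ| then
      (↑(|ξ| ^ α) : ℂ) * Complex.exp (Complex.I * (ξ * x)) * FT (fun y => F y t) ξ
    else 0

/-- Removing a decreasing amplitude from an integral (Abel summation). -/
lemma norm_integral_antitone_mul_le {A A' : ℝ → ℝ} {f : ℝ → ℂ} {b c D : ℝ} (hbc : b ≤ c)
    (hA : ∀ ξ ∈ Set.Icc b c, HasDerivAt A (A' ξ) ξ) (hA' : ContinuousOn A' (Set.Icc b c))
    (hneg : ∀ ξ ∈ Set.Icc b c, A' ξ ≤ 0) (hc : 0 ≤ A c) (hf : Continuous f)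
    (hD : ∀ s ∈ Set.Icc b c, ‖∫ ξ in b..s, f ξ‖ ≤ D) :
    ‖∫ ξ in b..c, (A ξ : ℂ) * f ξ‖ ≤ A b * D := by
  have hu : Set.uIcc b c = Set.Icc b c := Set.uIcc_of_le hbc
  have hF : ∀ s, HasDerivAt (fun s => ∫ ξ in b..s, f ξ) (f s) s := fun s =>
    intervalIntegral.integral_hasDerivAt_right (hf.intervalIntegrable _ _)
      hf.aestronglyMeasurable.stronglyMeasurableAtFilter hf.continuousAt
  have hA'i : IntervalIntegrable A' volume b c := (hu ▸ hA').intervalIntegrable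
  have hA'c : IntervalIntegrable (fun ξ => (A' ξ : ℂ)) volume b c :=
    ContinuousOn.intervalIntegrable (by
      rw [hu]; exact Complex.continuous_ofReal.comp_continuousOn hA')
  have key := intervalIntegral.integral_mul_deriv_eq_deriv_mul (a := b) (b := c)
    (u := fun ξ => (A ξ : ℂ)) (u' := fun ξ => (A' ξ : ℂ)) (v := fun s => ∫ ξ in b..s, f ξ)
    (v' := f) (fun x hx => (hA x (hu ▸ hx)).ofReal_comp) (fun x _ => hF x) hA'c
    (hf.intervalIntegrable _ _)
  rw [key]
  simp only [intervalIntegral.integral_same, mul_zero, sub_zero]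
  have hI : ‖∫ x in b..c, (A' x : ℂ) * ∫ ξ in b..x, f ξ‖ ≤ ∫ x in b..c, -A' x * D := by
    refine intervalIntegral.norm_integral_le_of_norm_le hbc ?_ (hA'i.neg.mul_const D)
    refine Filter.Eventually.of_forall fun x hx => ?_
    have hx' : x ∈ Set.Icc b c := ⟨hx.1.le, hx.2⟩
    rw [norm_mul, Complex.norm_real, Real.norm_eq_abs, abs_of_nonpos (hneg x hx')]
    exact mul_le_mul_of_nonneg_left (hD x hx') (by linarith [hneg x hx'])
  have hI2 : ∫ x in b..c, -A' x * D = (A b - A c) * D := by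
    rw [intervalIntegral.integral_mul_const, intervalIntegral.integral_neg,
      intervalIntegral.integral_eq_sub_of_hasDerivAt (fun x hx => hA x (hu ▸ hx)) hA'i]
    ring
  calc _ ≤ ‖(A c : ℂ) * ∫ ξ in b..c, f ξ‖ + ‖∫ x in b..c, (A' x : ℂ) * ∫ ξ in b..x, f ξ‖ :=
        norm_sub_le _ _
    _ ≤ A c * D + (A b - A c) * D := by
        gcongr
        · rw [norm_mul, Complex.norm_real, Real.norm_eq_abs, abs_of_nonneg hc]
          exact mul_le_mul_of_nonneg_left (hD c ⟨hbc, le_rfl⟩) hc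
        · exact hI.trans_eq hI2
    _ = A b * D := by ring

/-- First-derivative van der Corput estimate for a convex phase. -/
lemma norm_integral_exp_le_of_le_abs_deriv {ψ ψ' ψ'' : ℝ → ℝ} {b c m : ℝ} (hbc : b ≤ c)
    (hm : 0 < m) (h1 : ∀ ξ ∈ Set.Icc b c, HasDerivAt ψ (ψ' ξ) ξ)
    (h2 : ∀ ξ ∈ Set.Icc b c, HasDerivAt ψ' (ψ'' ξ) ξ)
    (hcont : ContinuousOn ψ'' (Set.Icc b c)) (hpos : ∀ ξ ∈ Set.Icc b c, 0 ≤ ψ'' ξ)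
    (hlow : ∀ ξ ∈ Set.Icc b c, m ≤ |ψ' ξ|) :
    ‖∫ ξ in b..c, Complex.exp (Complex.I * ψ ξ)‖ ≤ 4 / m := by
  have hu : Set.uIcc b c = Set.Icc b c := Set.uIcc_of_le hbc
  have hne : ∀ ξ ∈ Set.Icc b c, ψ' ξ ≠ 0 := fun ξ hξ h => by
    have := hlow ξ hξ; rw [h, abs_zero] at this; linarith
  have c1 : ContinuousOn ψ' (Set.Icc b c) := fun ξ hξ => (h2 ξ hξ).continuousAt.continuousWithinAt
  have c0 : ContinuousOn ψ (Set.Icc b c) := fun ξ hξ => (h1 ξ hξ).continuousAt.continuousWithinAt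
  have hr : ∀ ξ ∈ Set.Icc b c, HasDerivAt (fun ξ => (ψ' ξ)⁻¹) (-ψ'' ξ / ψ' ξ ^ 2) ξ :=
    fun ξ hξ => (h2 ξ hξ).inv (hne ξ hξ)
  have cr' : ContinuousOn (fun ξ => -ψ'' ξ / ψ' ξ ^ 2) (Set.Icc b c) :=
    hcont.neg.div (c1.pow 2) fun ξ hξ => pow_ne_zero 2 (hne ξ hξ)
  have hr'i : IntervalIntegrable (fun ξ => -ψ'' ξ / ψ' ξ ^ 2) volume b c :=
    ContinuousOn.intervalIntegrable (by rwa [hu])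
  have he : ∀ ξ ∈ Set.Icc b c, HasDerivAt (fun ξ => Complex.exp (Complex.I * ψ ξ))
      (Complex.exp (Complex.I * ψ ξ) * (Complex.I * ψ' ξ)) ξ := fun ξ hξ =>
    ((h1 ξ hξ).ofReal_comp.const_mul Complex.I).cexp
  have ce : ContinuousOn (fun ξ => Complex.exp (Complex.I * ψ ξ)) (Set.Icc b c) :=
    fun ξ hξ => (he ξ hξ).continuousAt.continuousWithinAt
  have key := intervalIntegral.integral_mul_deriv_eq_deriv_mul (a := b) (b := c)
    (u := fun ξ => (((ψ' ξ)⁻¹ : ℝ) : ℂ)) (u' := fun ξ => ((-ψ'' ξ / ψ' ξ ^ 2 : ℝ) : ℂ))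
    (v := fun ξ => Complex.exp (Complex.I * ψ ξ))
    (v' := fun ξ => Complex.exp (Complex.I * ψ ξ) * (Complex.I * ψ' ξ))
    (fun x hx => (hr x (hu ▸ hx)).ofReal_comp) (fun x hx => he x (hu ▸ hx))
    (ContinuousOn.intervalIntegrable (by
      rw [hu]; exact Complex.continuous_ofReal.comp_continuousOn cr'))
    (ContinuousOn.intervalIntegrable (by
      rw [hu]
      exact ce.mul (continuousOn_const.mul (Complex.continuous_ofReal.comp_continuousOn c1))))
  have hlhs : ∫ ξ in b..c, (((ψ' ξ)⁻¹ : ℝ) : ℂ) *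
      (Complex.exp (Complex.I * ψ ξ) * (Complex.I * ψ' ξ)) =
      Complex.I * ∫ ξ in b..c, Complex.exp (Complex.I * ψ ξ) := by
    rw [← intervalIntegral.integral_const_mul]
    refine intervalIntegral.integral_congr fun ξ hξ => ?_
    have : (ψ' ξ : ℂ) ≠ 0 := by exact_mod_cast hne ξ (hu ▸ hξ)
    simp only [Complex.ofReal_inv]
    field_simp
  have hn : ∀ y : ℝ, ‖Complex.exp (Complex.I * y)‖ = 1 := fun y => by
    rw [mul_comm]; exact Complex.norm_exp_ofReal_mul_I y
  have hrb : ∀ ξ ∈ Set.Icc b c, |(ψ' ξ)⁻¹| ≤ 1 / m := fun ξ hξ => by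
    rw [abs_inv, ← one_div]; exact one_div_le_one_div_of_le hm (hlow ξ hξ)
  have hI : ‖∫ ξ in b..c, ((-ψ'' ξ / ψ' ξ ^ 2 : ℝ) : ℂ) * Complex.exp (Complex.I * ψ ξ)‖ ≤
      ∫ ξ in b..c, -(-ψ'' ξ / ψ' ξ ^ 2) := by
    refine intervalIntegral.norm_integral_le_of_norm_le hbc ?_ hr'i.neg
    refine Filter.Eventually.of_forall fun x hx => ?_
    have hx' : x ∈ Set.Icc b c := ⟨hx.1.le, hx.2⟩
    rw [norm_mul, hn, mul_one, Complex.norm_real, Real.norm_eq_abs, abs_of_nonpos]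
    exact div_nonpos_of_nonpos_of_nonneg (by linarith [hpos x hx']) (sq_nonneg _)
  rw [intervalIntegral.integral_neg,
    intervalIntegral.integral_eq_sub_of_hasDerivAt (fun x hx => hr x (hu ▸ hx)) hr'i] at hI
  have hb := abs_le.1 (hrb b ⟨le_rfl, hbc⟩)
  have hc := abs_le.1 (hrb c ⟨hbc, le_rfl⟩)
  have hnorm : ‖∫ ξ in b..c, Complex.exp (Complex.I * ψ ξ)‖ =
      ‖Complex.I * ∫ ξ in b..c, Complex.exp (Complex.I * ψ ξ)‖ := by simp
  rw [hnorm, ← hlhs, key]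
  refine (norm_sub_le _ _).trans ((add_le_add (norm_sub_le _ _) hI).trans ?_)
  rw [norm_mul, norm_mul, hn, hn, Complex.norm_real, Complex.norm_real, Real.norm_eq_abs,
    Real.norm_eq_abs, mul_one, mul_one]
  have e : (4 : ℝ) / m = 1 / m + 1 / m + (1 / m + 1 / m) := by ring
  rw [e]
  linarith [hrb b ⟨le_rfl, hbc⟩, hrb c ⟨hbc, le_rfl⟩]

/-- A monotone continuous function crosses a given level at most once. -/
lemma exists_level_split {f : ℝ → ℝ} {b c : ℝ} (m : ℝ) (hbc : b ≤ c)
    (hf : ContinuousOn f (Set.Icc b c)) (hmono : MonotoneOn f (Set.Icc b c)) :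
    ∃ s ∈ Set.Icc b c, (b = s ∨ ∀ ξ ∈ Set.Icc b s, f ξ ≤ m) ∧
      (s = c ∨ ∀ ξ ∈ Set.Icc s c, m ≤ f ξ) := by
  by_cases h1 : m ≤ f b
  · exact ⟨b, ⟨le_rfl, hbc⟩, Or.inl rfl,
      Or.inr fun ξ hξ => h1.trans (hmono ⟨le_rfl, hbc⟩ hξ hξ.1)⟩
  by_cases h2 : f c ≤ m
  · exact ⟨c, ⟨hbc, le_rfl⟩,
      Or.inr fun ξ hξ => (hmono hξ ⟨hbc, le_rfl⟩ hξ.2).trans h2, Or.inl rfl⟩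
  obtain ⟨s, hs, rfl⟩ := intermediate_value_Icc hbc hf ⟨(not_le.1 h1).le, (not_le.1 h2).le⟩
  exact ⟨s, hs, Or.inr fun ξ hξ => hmono ⟨hξ.1, hξ.2.trans hs.2⟩ hs hξ.2,
    Or.inr fun ξ hξ => hmono hs ⟨hs.1.trans hξ.1, hξ.2⟩ hξ.1⟩

/-- First-derivative van der Corput estimate with decreasing amplitude. -/
lemma norm_integral_mul_exp_le_of_le_abs_deriv {A A' ψ ψ' ψ'' : ℝ → ℝ} {b c m : ℝ}
    (hbc : b ≤ c) (hm : 0 < m)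
    (hA : ∀ ξ ∈ Set.Icc b c, HasDerivAt A (A' ξ) ξ) (hA' : ContinuousOn A' (Set.Icc b c))
    (hneg : ∀ ξ ∈ Set.Icc b c, A' ξ ≤ 0) (hc : 0 ≤ A c) (hψ : Continuous ψ)
    (h1 : ∀ ξ ∈ Set.Icc b c, HasDerivAt ψ (ψ' ξ) ξ)
    (h2 : ∀ ξ ∈ Set.Icc b c, HasDerivAt ψ' (ψ'' ξ) ξ)
    (hcont : ContinuousOn ψ'' (Set.Icc b c)) (hpos : ∀ ξ ∈ Set.Icc b c, 0 ≤ ψ'' ξ)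
    (hlow : ∀ ξ ∈ Set.Icc b c, m ≤ |ψ' ξ|) :
    ‖∫ ξ in b..c, (A ξ : ℂ) * Complex.exp (Complex.I * ψ ξ)‖ ≤ A b * (4 / m) := by
  refine norm_integral_antitone_mul_le hbc hA hA' hneg hc (by fun_prop) fun s hs => ?_
  have hsub : Set.Icc b s ⊆ Set.Icc b c := Set.Icc_subset_Icc_right hs.2
  exact norm_integral_exp_le_of_le_abs_deriv hs.1 hm (fun ξ hξ => h1 ξ (hsub hξ))
    (fun ξ hξ => h2 ξ (hsub hξ)) (hcont.mono hsub) (fun ξ hξ => hpos ξ (hsub hξ))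
    (fun ξ hξ => hlow ξ (hsub hξ))

/-- Up to a van der Corput error, an oscillatory integral with convex phase is supported on the
interval where the derivative of the phase is small. -/
lemma exists_stationary_interval {A A' ψ ψ' ψ'' : ℝ → ℝ} {b c m : ℝ} (hbc : b ≤ c) (hm : 0 < m)
    (hA : ∀ ξ ∈ Set.Icc b c, HasDerivAt A (A' ξ) ξ) (hA' : ContinuousOn A' (Set.Icc b c))
    (hneg : ∀ ξ ∈ Set.Icc b c, A' ξ ≤ 0) (hA0 : ∀ ξ ∈ Set.Icc b c, 0 ≤ A ξ)
    (hψ : Continuous ψ)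
    (h1 : ∀ ξ ∈ Set.Icc b c, HasDerivAt ψ (ψ' ξ) ξ)
    (h2 : ∀ ξ ∈ Set.Icc b c, HasDerivAt ψ' (ψ'' ξ) ξ)
    (hcont : ContinuousOn ψ'' (Set.Icc b c)) (hpos : ∀ ξ ∈ Set.Icc b c, 0 ≤ ψ'' ξ) :
    ∃ s₁ s₂, b ≤ s₁ ∧ s₁ ≤ s₂ ∧ s₂ ≤ c ∧ (s₁ = s₂ ∨ ∀ ξ ∈ Set.Icc s₁ s₂, |ψ' ξ| ≤ m) ∧
      ‖∫ ξ in b..c, (A ξ : ℂ) * Complex.exp (Complex.I * ψ ξ)‖ ≤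
        ‖∫ ξ in s₁..s₂, (A ξ : ℂ) * Complex.exp (Complex.I * ψ ξ)‖ + A b * (8 / m) := by
  have c1 : ContinuousOn ψ' (Set.Icc b c) := fun ξ hξ => (h2 ξ hξ).continuousAt.continuousWithinAt
  have cA : ContinuousOn A (Set.Icc b c) := fun ξ hξ => (hA ξ hξ).continuousAt.continuousWithinAt
  have hincl : interior (Set.Icc b c) ⊆ Set.Icc b c := interior_subset
  have mono : MonotoneOn ψ' (Set.Icc b c) :=
    monotoneOn_of_hasDerivWithinAt_nonneg (convex_Icc b c) c1
      (fun ξ hξ => (h2 ξ (hincl hξ)).hasDerivWithinAt) (fun ξ hξ => hpos ξ (hincl hξ))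
  have anti : AntitoneOn A (Set.Icc b c) :=
    antitoneOn_of_hasDerivWithinAt_nonpos (convex_Icc b c) cA
      (fun ξ hξ => (hA ξ (hincl hξ)).hasDerivWithinAt) (fun ξ hξ => hneg ξ (hincl hξ))
  have hfi : ∀ x y, x ∈ Set.Icc b c → y ∈ Set.Icc b c → IntervalIntegrable
      (fun ξ => (A ξ : ℂ) * Complex.exp (Complex.I * ψ ξ)) volume x y := by
    intro x y hx hy
    refine ContinuousOn.intervalIntegrable ?_
    have hs : Set.uIcc x y ⊆ Set.Icc b c := Set.uIcc_subset_Icc hx hy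
    exact ((Complex.continuous_ofReal.comp_continuousOn cA).mul
      (by fun_prop : Continuous fun ξ => Complex.exp (Complex.I * ψ ξ)).continuousOn).mono hs
  have hb0 : 0 ≤ A b * (4 / m) := mul_nonneg (hA0 b ⟨le_rfl, hbc⟩) (by positivity)
  have side : ∀ x y, b ≤ x → x ≤ y → y ≤ c → (x = y ∨ ∀ ξ ∈ Set.Icc x y, m ≤ |ψ' ξ|) →
      ‖∫ ξ in x..y, (A ξ : ℂ) * Complex.exp (Complex.I * ψ ξ)‖ ≤ A b * (4 / m) := by
    intro x y hx hxy hy h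
    rcases h with rfl | h
    · simpa using hb0
    have hs : Set.Icc x y ⊆ Set.Icc b c := Set.Icc_subset_Icc hx hy
    refine (norm_integral_mul_exp_le_of_le_abs_deriv hxy hm (fun ξ hξ => hA ξ (hs hξ))
      (hA'.mono hs) (fun ξ hξ => hneg ξ (hs hξ)) (hA0 y ⟨hx.trans hxy, hy⟩) hψ
      (fun ξ hξ => h1 ξ (hs hξ)) (fun ξ hξ => h2 ξ (hs hξ)) (hcont.mono hs)
      (fun ξ hξ => hpos ξ (hs hξ)) h).trans ?_
    exact mul_le_mul_of_nonneg_right (anti ⟨le_rfl, hbc⟩ ⟨hx, hxy.trans hy⟩ hx) (by positivity)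
  obtain ⟨s₁, hs₁, hl₁, hr₁⟩ := exists_level_split (-m) hbc c1 mono
  have hs' : Set.Icc s₁ c ⊆ Set.Icc b c := Set.Icc_subset_Icc_left hs₁.1
  obtain ⟨s₂, hs₂, hl₂, hr₂⟩ := exists_level_split m hs₁.2 (c1.mono hs') (mono.mono hs')
  refine ⟨s₁, s₂, hs₁.1, hs₂.1, hs₂.2, ?_, ?_⟩
  · rcases hr₁ with h | h
    · exact Or.inl (le_antisymm hs₂.1 (hs₂.2.trans h.ge))
    rcases hl₂ with h' | h'
    · exact Or.inl h'
    exact Or.inr fun ξ hξ => abs_le.2 ⟨h ξ ⟨hξ.1, hξ.2.trans hs₂.2⟩, h' ξ hξ⟩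
  · have i1 := side b s₁ le_rfl hs₁.1 hs₁.2 (hl₁.imp id fun h ξ hξ => by
      have := h ξ hξ; rw [abs_of_nonpos (by linarith)]; linarith)
    have i2 := side s₂ c (hs₁.1.trans hs₂.1) hs₂.2 le_rfl (hr₂.imp id fun h ξ hξ => by
      have := h ξ hξ; rw [abs_of_nonneg (by linarith)]; linarith)
    have hbm : b ∈ Set.Icc b c := ⟨le_rfl, hbc⟩
    have hcm : c ∈ Set.Icc b c := ⟨hbc, le_rfl⟩
    rw [← intervalIntegral.integral_add_adjacent_intervals (hfi b s₁ hbm hs₁) (hfi s₁ c hs₁ hcm),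
      ← intervalIntegral.integral_add_adjacent_intervals (hfi s₁ s₂ hs₁ (hs' hs₂))
        (hfi s₂ c (hs' hs₂) hcm)]
    have e : A b * (8 / m) = A b * (4 / m) + A b * (4 / m) := by ring
    rw [e]
    refine (norm_add_le _ _).trans ?_
    have := norm_add_le (∫ ξ in s₁..s₂, (A ξ : ℂ) * Complex.exp (Complex.I * ψ ξ))
      (∫ ξ in s₂..c, (A ξ : ℂ) * Complex.exp (Complex.I * ψ ξ))
    linarith

lemma integral_rpow_neg_half {b c : ℝ} :
    ∫ ξ in b..c, ξ ^ (-(1 / 2) : ℝ) = 2 * (c ^ (1 / 2 : ℝ) - b ^ (1 / 2 : ℝ)) := by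
  rw [integral_rpow (Or.inl (by norm_num))]
  norm_num; ring

/-- Kernel estimate on a half-line, for a normalised convex phase. -/
lemma norm_integral_kernel_le_of_nonneg {κ a t x c : ℝ} (ha : 2 ≤ a) (haκ : 4 / 3 * |κ| ≤ a)
    (ht : 0 ≤ t) (hx : x ≠ 0) (hac : a ≤ c) :
    ‖∫ ξ in a..c, ((ξ ^ (-(1 / 2) : ℝ) : ℝ) : ℂ) *
      Complex.exp (Complex.I * ((x * ξ + t * (ξ ^ 3 - κ * ξ ^ 2) : ℝ) : ℂ))‖ ≤
      30 * |x| ^ (-(1 / 2) : ℝ) := by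
  set ψ : ℝ → ℝ := fun ξ => x * ξ + t * (ξ ^ 3 - κ * ξ ^ 2) with hψdef
  set ψ' : ℝ → ℝ := fun ξ => x + t * (3 * ξ ^ 2 - 2 * κ * ξ) with hψ'def
  set ψ'' : ℝ → ℝ := fun ξ => t * (6 * ξ - 2 * κ) with hψ''def
  set A : ℝ → ℝ := fun ξ => ξ ^ (-(1 / 2) : ℝ) with hAdef
  set A' : ℝ → ℝ := fun ξ => (-(1 / 2)) * ξ ^ (-(1 / 2) - 1 : ℝ) with hA'def
  have hX : 0 < |x| := abs_pos.2 hx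
  have hψ : Continuous ψ := by fun_prop
  have h1 : ∀ ξ, HasDerivAt ψ (ψ' ξ) ξ := fun ξ => by
    have := ((hasDerivAt_id ξ).const_mul x).add
      (((hasDerivAt_pow 3 ξ).sub ((hasDerivAt_pow 2 ξ).const_mul κ)).const_mul t)
    refine HasDerivAt.congr_deriv (f := ψ) this ?_
    simp only [hψ'def]; push_cast; ring
  have h2 : ∀ ξ, HasDerivAt ψ' (ψ'' ξ) ξ := fun ξ => by
    have := (((((hasDerivAt_pow 2 ξ).const_mul 3).sub
      ((hasDerivAt_id ξ).const_mul (2 * κ)))).const_mul t).const_add x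
    refine HasDerivAt.congr_deriv (f := ψ') this ?_
    simp only [hψ''def]; push_cast; ring
  have hcont : Continuous ψ'' := by fun_prop
  have hκ : ∀ ξ, a ≤ ξ → 4 / 3 * κ ≤ ξ := fun ξ hξ => by linarith [le_abs_self κ]
  have hκ' : ∀ ξ, a ≤ ξ → -(4 / 3 * κ) ≤ ξ := fun ξ hξ => by linarith [neg_le_abs κ]
  have hψ''l : ∀ ξ, a ≤ ξ → t * (9 / 2 * ξ) ≤ ψ'' ξ := fun ξ hξ =>
    mul_le_mul_of_nonneg_left (by linarith [hκ ξ hξ]) ht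
  have hpos : ∀ ξ, a ≤ ξ → 0 ≤ ψ'' ξ := fun ξ hξ =>
    le_trans (mul_nonneg ht (by linarith)) (hψ''l ξ hξ)
  have hA : ∀ ξ, a ≤ ξ → HasDerivAt A (A' ξ) ξ := fun ξ hξ =>
    Real.hasDerivAt_rpow_const (Or.inl (by linarith))
  have hA'c : ContinuousOn A' (Set.Ici a) := fun ξ hξ =>
    ((Real.continuousAt_rpow_const ξ _ (Or.inl (by
      have : a ≤ ξ := hξ
      linarith))).const_mul _).continuousWithinAt
  have hneg : ∀ ξ, a ≤ ξ → A' ξ ≤ 0 := fun ξ hξ => by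
    have : 0 ≤ ξ ^ (-(1 / 2) - 1 : ℝ) := Real.rpow_nonneg (by linarith) _
    simp only [hA'def]; linarith
  have hA0 : ∀ ξ, a ≤ ξ → 0 ≤ A ξ := fun ξ hξ => Real.rpow_nonneg (by linarith) _
  have hn : ∀ y : ℝ, ‖Complex.exp (Complex.I * y)‖ = 1 := fun y => by
    rw [mul_comm]; exact Complex.norm_exp_ofReal_mul_I y
  -- trivial estimate
  have triv : ∀ p q, a ≤ p → p ≤ q →
      ‖∫ ξ in p..q, (A ξ : ℂ) * Complex.exp (Complex.I * ψ ξ)‖ ≤ ∫ ξ in p..q, A ξ := by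
    intro p q hp hpq
    refine intervalIntegral.norm_integral_le_of_norm_le hpq (Filter.Eventually.of_forall
      fun ξ hξ => ?_) (intervalIntegral.intervalIntegrable_rpow' (by norm_num))
    rw [norm_mul, hn, mul_one, Complex.norm_real, Real.norm_eq_abs,
      abs_of_nonneg (hA0 ξ (hp.trans hξ.1.le))]
  -- main estimate away from low frequencies
  have main : ∀ b, a ≤ b → b ≤ c → 1 / |x| ≤ b →
      ‖∫ ξ in b..c, (A ξ : ℂ) * Complex.exp (Complex.I * ψ ξ)‖ ≤
        28 * |x| ^ (-(1 / 2) : ℝ) := by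
    intro b hab hbc hxb
    have hsub : ∀ {p q}, b ≤ p → ∀ ξ ∈ Set.Icc p q, a ≤ ξ := fun hp ξ hξ =>
      hab.trans (hp.trans hξ.1)
    obtain ⟨s₁, s₂, hbs, hss, hsc, hst, hle⟩ := exists_stationary_interval (A := A) (A' := A')
      (ψ := ψ) (ψ' := ψ') (ψ'' := ψ'') hbc (half_pos hX)
      (fun ξ hξ => hA ξ (hsub le_rfl ξ hξ)) (hA'c.mono fun ξ hξ => hsub le_rfl ξ hξ)
      (fun ξ hξ => hneg ξ (hsub le_rfl ξ hξ)) (fun ξ hξ => hA0 ξ (hsub le_rfl ξ hξ)) hψ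
      (fun ξ _ => h1 ξ) (fun ξ _ => h2 ξ) hcont.continuousOn
      (fun ξ hξ => hpos ξ (hsub le_rfl ξ hξ))
    have hb0 : 0 < b := by linarith
    have hAb : A b * (8 / (|x| / 2)) ≤ 16 * |x| ^ (-(1 / 2) : ℝ) := by
      have e1 : A b ≤ |x| ^ (1 / 2 : ℝ) := by
        have := Real.rpow_le_rpow_of_nonpos (z := (-(1 / 2) : ℝ)) (one_div_pos.2 hX) hxb
          (by norm_num)
        refine this.trans_eq ?_
        rw [one_div, Real.inv_rpow hX.le, ← Real.rpow_neg hX.le, neg_neg]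
      have e2 : |x| ^ (1 / 2 : ℝ) * (8 / (|x| / 2)) = 16 * |x| ^ (-(1 / 2) : ℝ) := by
        have : |x| ^ (-(1 / 2) : ℝ) = |x| ^ (1 / 2 : ℝ) * |x|⁻¹ := by
          rw [← Real.rpow_neg_one, ← Real.rpow_add hX]; norm_num
        rw [this]; field_simp; norm_num
      rw [← e2]; gcongr
    have hx0 : 0 ≤ |x| ^ (-(1 / 2) : ℝ) := Real.rpow_nonneg hX.le _
    rcases hst with h | hst
    · rw [h, intervalIntegral.integral_same, norm_zero] at hle
      linarith
    have has : a ≤ s₁ := hab.trans hbs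
    have hs0 : 0 < s₁ := by linarith
    set δ := |x| ^ (1 / 2 : ℝ) * s₁ ^ (-(1 / 2) : ℝ) with hδ
    have hδ0 : 0 < δ := by positivity
    obtain ⟨r₁, r₂, hr1, hr, hr2, hrst, hrle⟩ := exists_stationary_interval (A := A) (A' := A')
      (ψ := ψ) (ψ' := ψ') (ψ'' := ψ'') hss hδ0
      (fun ξ hξ => hA ξ (hsub hbs ξ hξ)) (hA'c.mono fun ξ hξ => hsub hbs ξ hξ)
      (fun ξ hξ => hneg ξ (hsub hbs ξ hξ)) (fun ξ hξ => hA0 ξ (hsub hbs ξ hξ)) hψ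
      (fun ξ _ => h1 ξ) (fun ξ _ => h2 ξ) hcont.continuousOn
      (fun ξ hξ => hpos ξ (hsub hbs ξ hξ))
    have hAs : A s₁ * (8 / δ) = 8 * |x| ^ (-(1 / 2) : ℝ) := by
      have : A s₁ ≠ 0 := (Real.rpow_pos_of_pos hs0 _).ne'
      rw [hδ, Real.rpow_neg hX.le]
      change A s₁ * (8 / (_ * A s₁)) = _
      field_simp
    have hmid : ‖∫ ξ in r₁..r₂, (A ξ : ℂ) * Complex.exp (Complex.I * ψ ξ)‖ ≤
        4 * |x| ^ (-(1 / 2) : ℝ) := by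
      rcases hrst with h | hrst
      · rw [h, intervalIntegral.integral_same, norm_zero]; positivity
      have hts : |x| / 9 ≤ t * s₁ ^ 2 := by
        have q := hst s₁ ⟨le_rfl, hss⟩
        have q1 : |x| ≤ |ψ' s₁| + |t * (3 * s₁ ^ 2 - 2 * κ * s₁)| := by
          have : x = ψ' s₁ - t * (3 * s₁ ^ 2 - 2 * κ * s₁) := by simp only [hψ'def]; ring
          calc |x| = |ψ' s₁ - t * (3 * s₁ ^ 2 - 2 * κ * s₁)| := by rw [← this]
            _ ≤ _ := abs_sub _ _
        have q2 : |t * (3 * s₁ ^ 2 - 2 * κ * s₁)| ≤ t * (9 / 2 * s₁ ^ 2) := by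
          rw [abs_mul, abs_of_nonneg ht]
          refine mul_le_mul_of_nonneg_left (abs_le.2 ⟨?_, ?_⟩) ht
          · nlinarith [hκ s₁ has, hκ' s₁ has]
          · nlinarith [hκ s₁ has, hκ' s₁ has]
        linarith
      -- length of the stationary interval
      have hlen : (t * (9 / 2 * s₁)) * (r₂ - r₁) ≤ 2 * δ := by
        have hmvt : (t * (9 / 2 * s₁)) * (r₂ - r₁) ≤ ψ' r₂ - ψ' r₁ := by
          refine (convex_Icc r₁ r₂).mul_sub_le_image_sub_of_le_deriv
            (fun ξ _ => (h2 ξ).continuousAt.continuousWithinAt)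
            (fun ξ _ => (h2 ξ).differentiableAt.differentiableWithinAt) ?_ r₁ ⟨le_rfl, hr⟩ r₂
            ⟨hr, le_rfl⟩ hr
          intro ξ hξ
          rw [(h2 ξ).deriv]
          have hξ' := interior_subset hξ
          refine le_trans ?_ (hψ''l ξ (has.trans (hr1.trans hξ'.1)))
          refine mul_le_mul_of_nonneg_left ?_ ht
          linarith [hr1.trans hξ'.1]
        have := abs_le.1 (hrst r₁ ⟨le_rfl, hr⟩)
        have := abs_le.1 (hrst r₂ ⟨hr, le_rfl⟩)
        linarith
      have hlen2 : |x| * (r₂ - r₁) ≤ 4 * s₁ * δ := by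
        have : |x| / 2 * (r₂ - r₁) ≤ s₁ * (2 * δ) := by
          calc |x| / 2 * (r₂ - r₁) ≤ (9 / 2 * (t * s₁ ^ 2)) * (r₂ - r₁) :=
                mul_le_mul_of_nonneg_right (by linarith) (by linarith)
            _ = s₁ * ((t * (9 / 2 * s₁)) * (r₂ - r₁)) := by ring
            _ ≤ _ := mul_le_mul_of_nonneg_left hlen hs0.le
        linarith
      have hA1 : ‖∫ ξ in r₁..r₂, (A ξ : ℂ) * Complex.exp (Complex.I * ψ ξ)‖ ≤
          A s₁ * |r₂ - r₁| := by
        refine intervalIntegral.norm_integral_le_of_norm_le_const fun ξ hξ => ?_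
        rw [Set.uIoc_of_le hr] at hξ
        have hξs : s₁ ≤ ξ := hr1.trans hξ.1.le
        rw [norm_mul, hn, mul_one, Complex.norm_real, Real.norm_eq_abs,
          abs_of_nonneg (hA0 ξ (has.trans hξs))]
        exact Real.rpow_le_rpow_of_nonpos hs0 hξs (by norm_num)
      rw [abs_of_nonneg (by linarith)] at hA1
      refine hA1.trans ?_
      have e1 : r₂ - r₁ ≤ 4 * s₁ * δ / |x| := by
        rw [le_div_iff₀ hX]; linarith
      calc A s₁ * (r₂ - r₁) ≤ A s₁ * (4 * s₁ * δ / |x|) :=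
            mul_le_mul_of_nonneg_left e1 (hA0 s₁ has)
        _ = 4 * (s₁ ^ (-(1 / 2) : ℝ) * s₁ ^ (-(1 / 2) : ℝ) * s₁) *
            (|x| ^ (1 / 2 : ℝ) * |x|⁻¹) := by
            simp only [hAdef, hδ]; field_simp
        _ = 4 * |x| ^ (-(1 / 2) : ℝ) := by
            have g1 : s₁ ^ (-(1 / 2) : ℝ) * s₁ ^ (-(1 / 2) : ℝ) * s₁ = 1 := by
              rw [← Real.rpow_add hs0]
              norm_num
              rw [Real.rpow_neg_one, inv_mul_cancel₀ hs0.ne']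
            have g2 : |x| ^ (1 / 2 : ℝ) * |x|⁻¹ = |x| ^ (-(1 / 2) : ℝ) := by
              rw [← Real.rpow_neg_one, ← Real.rpow_add hX]; norm_num
            rw [g1, g2, mul_one]
    linarith
  have hx0 : 0 ≤ |x| ^ (-(1 / 2) : ℝ) := Real.rpow_nonneg hX.le _
  have low : ∀ p, a ≤ p → p ≤ 1 / |x| →
      ‖∫ ξ in a..p, (A ξ : ℂ) * Complex.exp (Complex.I * ψ ξ)‖ ≤
        2 * |x| ^ (-(1 / 2) : ℝ) := by
    intro p hap hp
    refine (triv a p le_rfl hap).trans ?_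
    rw [hAdef, integral_rpow_neg_half]
    have e1 : p ^ (1 / 2 : ℝ) ≤ |x| ^ (-(1 / 2) : ℝ) := by
      refine (Real.rpow_le_rpow (by linarith) hp (by norm_num)).trans_eq ?_
      rw [one_div, Real.inv_rpow hX.le, ← Real.rpow_neg hX.le]
    have e2 : 0 ≤ a ^ (1 / 2 : ℝ) := Real.rpow_nonneg (by linarith) _
    linarith
  rcases le_total (1 / |x|) a with h | h
  · exact (main a le_rfl hac h).trans (by linarith)
  rcases le_total c (1 / |x|) with h' | h'
  · exact (low c hac h').trans (by linarith)
  have hfi : ∀ p q, a ≤ p → a ≤ q → IntervalIntegrable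
      (fun ξ => (A ξ : ℂ) * Complex.exp (Complex.I * ψ ξ)) volume p q := by
    intro p q hp hq
    refine ContinuousOn.intervalIntegrable fun ξ hξ => ?_
    have haξ : a ≤ ξ := (le_min hp hq).trans hξ.1
    exact ((Complex.continuous_ofReal.continuousAt.comp (hA ξ haξ).continuousAt).mul
      (by fun_prop : Continuous fun ξ => Complex.exp (Complex.I * ψ ξ)).continuousAt
      ).continuousWithinAt
  have := intervalIntegral.integral_add_adjacent_intervals (hfi a (1 / |x|) le_rfl h)
    (hfi (1 / |x|) c h hac)
  change ‖∫ ξ in a..c, (A ξ : ℂ) * Complex.exp (Complex.I * ψ ξ)‖ ≤ _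
  rw [← this]
  have i1 := low (1 / |x|) h le_rfl
  have i2 := main (1 / |x|) h h' le_rfl
  exact (norm_add_le _ _).trans (by linarith)

/-- The plane wave `e^{i(xξ + tφ(ξ))}`. -/
def planeWave (ν μ x t ξ : ℝ) : ℂ := Complex.exp (Complex.I * (ξ * x + phase ν μ ξ * t))

/-- The frequency band `a ≤ |ξ| < k`. -/
def freqBand (a k : ℝ) : Set ℝ := {ξ | a ≤ |ξ| ∧ |ξ| < k}

lemma planeWave_eq (ν μ x t ξ : ℝ) :
    planeWave ν μ x t ξ = Complex.exp (Complex.I * ((ξ * x + phase ν μ ξ * t : ℝ) : ℂ)) := by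
  simp [planeWave]

lemma norm_planeWave (ν μ x t ξ : ℝ) : ‖planeWave ν μ x t ξ‖ = 1 := by
  rw [planeWave_eq, mul_comm]; exact Complex.norm_exp_ofReal_mul_I _

lemma planeWave_mul_conj (ν μ x t y s ξ : ℝ) :
    planeWave ν μ x t ξ * (starRingEnd ℂ) (planeWave ν μ y s ξ) =
      planeWave ν μ (x - y) (t - s) ξ := by
  rw [planeWave_eq, planeWave_eq, planeWave_eq, ← Complex.exp_conj, ← Complex.exp_add]
  congr 1
  simp only [map_mul, Complex.conj_I, Complex.conj_ofReal]
  push_cast; ring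

lemma continuous_phase (ν μ : ℝ) : Continuous (phase ν μ) := by
  unfold phase; fun_prop

lemma continuous_planeWave (ν μ : ℝ) :
    Continuous fun p : ℝ × ℝ × ℝ => planeWave ν μ p.1 p.2.1 p.2.2 := by
  have := continuous_phase ν μ
  unfold planeWave; fun_prop

lemma measurableSet_freqBand (a k : ℝ) : MeasurableSet (freqBand a k) :=
  (measurableSet_le measurable_const measurable_id.norm).inter
    (measurableSet_lt measurable_id.norm measurable_const)

lemma two_le_aconst (ν μ : ℝ) : 2 ≤ aconst ν μ := by
  have := le_max_left 1 |2 * ν / (3 * μ)|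
  unfold aconst; linarith

lemma four_thirds_mul_abs_le_aconst (ν μ : ℝ) : 4 / 3 * |ν / μ| ≤ aconst ν μ := by
  have h := le_max_right 1 |2 * ν / (3 * μ)|
  have e : |2 * ν / (3 * μ)| = 2 / 3 * |ν / μ| := by
    rw [show 2 * ν / (3 * μ) = 2 / 3 * (ν / μ) by rw [div_mul_div_comm], abs_mul]
    norm_num
  unfold aconst; linarith

/-- Kernel estimate on a half-line, for both signs of time. -/
lemma norm_integral_kernel_le {κ a x c : ℝ} (t : ℝ) (ha : 2 ≤ a) (haκ : 4 / 3 * |κ| ≤ a)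
    (hx : x ≠ 0) (hac : a ≤ c) :
    ‖∫ ξ in a..c, ((ξ ^ (-(1 / 2) : ℝ) : ℝ) : ℂ) *
      Complex.exp (Complex.I * ((x * ξ + t * (ξ ^ 3 - κ * ξ ^ 2) : ℝ) : ℂ))‖ ≤
      30 * |x| ^ (-(1 / 2) : ℝ) := by
  rcases le_total 0 t with ht | ht
  · exact norm_integral_kernel_le_of_nonneg ha haκ ht hx hac
  have := norm_integral_kernel_le_of_nonneg (t := -t) (x := -x) ha haκ (by linarith)
    (neg_ne_zero.2 hx) hac
  rw [abs_neg, ← Complex.norm_conj, intervalIntegral.integral_of_le hac, ← integral_conj] at this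
  rw [intervalIntegral.integral_of_le hac]
  refine le_of_eq_of_le (congrArg norm (integral_congr_ae
    (Filter.Eventually.of_forall fun ξ => ?_))) this
  simp only
  rw [map_mul, Complex.conj_ofReal, ← Complex.exp_conj]
  congr 2
  simp only [map_mul, Complex.conj_I, Complex.conj_ofReal]
  push_cast; ring

/-- The dispersive kernel bound, uniform in time and in the frequency truncation. -/
lemma norm_setIntegral_freqBand_le {ν μ x : ℝ} (hμ : μ ≠ 0) (t k : ℝ) (hx : x ≠ 0) :
    ‖∫ ξ in freqBand (aconst ν μ) k, ((|ξ| ^ (-(1 / 2) : ℝ) : ℝ) : ℂ) * planeWave ν μ x t ξ‖ ≤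
      60 * |x| ^ (-(1 / 2) : ℝ) := by
  have ha := two_le_aconst ν μ
  have hκ := four_thirds_mul_abs_le_aconst ν μ
  set a := aconst ν μ
  rcases le_total k a with hk | hk
  · have : freqBand a k = ∅ := by
      ext ξ; simp only [freqBand, Set.mem_ofPred_eq, Set.mem_empty_iff_false, iff_false]
      rintro ⟨h1, h2⟩; linarith
    rw [this]; simp; positivity
  have hset : freqBand a k = Set.Ico a k ∪ Set.Ioc (-k) (-a) := by
    ext ξ
    simp only [freqBand, Set.mem_ofPred_eq, Set.mem_union, Set.mem_Ico, Set.mem_Ioc]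
    rcases le_total 0 ξ with h | h
    · rw [abs_of_nonneg h]
      exact ⟨fun h' => Or.inl h', fun h' => h'.elim id fun h'' => by linarith [h''.2]⟩
    · rw [abs_of_nonpos h]
      constructor
      · rintro ⟨h1, h2⟩; right; constructor <;> linarith
      · rintro (⟨h1, h2⟩ | ⟨h1, h2⟩) <;> constructor <;> linarith
  have hdisj : Disjoint (Set.Ico a k) (Set.Ioc (-k) (-a)) :=
    Set.disjoint_left.2 fun ξ h1 h2 => by linarith [h1.1, h2.2]
  have hci : ∀ s : Set ℝ, IsCompact s → (∀ ξ ∈ s, ξ ≠ 0) → IntegrableOn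
      (fun ξ => ((|ξ| ^ (-(1 / 2) : ℝ) : ℝ) : ℂ) * planeWave ν μ x t ξ) s := by
    intro s hs h0
    refine ContinuousOn.integrableOn_compact hs (ContinuousOn.mul ?_ ?_)
    · exact Complex.continuous_ofReal.comp_continuousOn
        (continuous_abs.continuousOn.rpow_const fun ξ hξ => Or.inl (abs_ne_zero.2 (h0 ξ hξ)))
    · exact ((continuous_planeWave ν μ).comp
        (by fun_prop : Continuous fun ξ : ℝ => (x, t, ξ))).continuousOn
  have hpos : ∀ ξ, 0 ≤ ξ → ∀ y s : ℝ, planeWave ν μ y s ξ = Complex.exp (Complex.I *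
      ((y * ξ + (s * μ) * (ξ ^ 3 - ν / μ * ξ ^ 2) : ℝ) : ℂ)) := by
    intro ξ hξ y s
    rw [planeWave_eq]
    congr 3
    unfold phase
    rw [abs_of_nonneg hξ]
    field_simp; ring
  have hneg : ∀ ξ, planeWave ν μ x t (-ξ) = planeWave ν μ (-x) (-t) ξ := by
    intro ξ
    rw [planeWave_eq, planeWave_eq]
    congr 3
    unfold phase
    rw [abs_neg]; ring
  rw [hset, setIntegral_union hdisj measurableSet_Ioc
    ((hci (Set.Icc a k) isCompact_Icc fun ξ hξ => by
      have := hξ.1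
      exact (by linarith : 0 < ξ).ne').mono_set Set.Ico_subset_Icc_self)
    ((hci (Set.Icc (-k) (-a)) isCompact_Icc fun ξ hξ => by
      have := hξ.2
      exact (by linarith : ξ < 0).ne).mono_set Set.Ioc_subset_Icc_self)]
  rw [integral_Ico_eq_integral_Ioc, ← intervalIntegral.integral_of_le hk,
    ← intervalIntegral.integral_of_le (neg_le_neg hk), ← intervalIntegral.integral_comp_neg]
  have conv : ∀ y s : ℝ, (∫ ξ in a..k, ((|ξ| ^ (-(1 / 2) : ℝ) : ℝ) : ℂ) * planeWave ν μ y s ξ) =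
      ∫ ξ in a..k, ((ξ ^ (-(1 / 2) : ℝ) : ℝ) : ℂ) *
      Complex.exp (Complex.I * ((y * ξ + (s * μ) * (ξ ^ 3 - ν / μ * ξ ^ 2) : ℝ) : ℂ)) := by
    intro y s
    refine intervalIntegral.integral_congr fun ξ hξ => ?_
    rw [Set.uIcc_of_le hk] at hξ
    have h0 : 0 ≤ ξ := by linarith [hξ.1]
    simp only [abs_of_nonneg h0, hpos ξ h0]
  have i1 := norm_integral_kernel_le (t * μ) ha hκ hx hk
  have i2 := norm_integral_kernel_le (-t * μ) ha hκ (neg_ne_zero.2 hx) hk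
  rw [← conv] at i1 i2
  rw [abs_neg] at i2
  simp only [abs_neg, hneg]
  exact (norm_add_le _ _).trans (by linarith)

lemma lintegral_comp_abs_eq (g : ℝ → ℝ≥0∞) :
    ∫⁻ u, g |u| = 2 * ∫⁻ u in Set.Ioi (0 : ℝ), g u := by
  rw [← lintegral_add_compl _ (measurableSet_Ioi : MeasurableSet (Set.Ioi (0 : ℝ))), two_mul]
  congr 1
  · exact setLIntegral_congr_fun measurableSet_Ioi fun u hu => by
      simp only [abs_of_pos (Set.mem_Ioi.1 hu)]
  · have hmp := (Measure.measurePreserving_neg (volume : Measure ℝ)).setLIntegral_comp_preimage_emb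
      (MeasurableEquiv.neg ℝ).measurableEmbedding (fun u => g |u|) (Set.Ioi (0 : ℝ))
    rw [Set.compl_Ioi, setLIntegral_congr (Iio_ae_eq_Iic (a := (0 : ℝ))).symm]
    have hpre : (Neg.neg : ℝ → ℝ) ⁻¹' Set.Ioi 0 = Set.Iio 0 := by ext; simp
    have e : ∫⁻ u in Set.Ioi (0 : ℝ), g u = ∫⁻ u in Set.Ioi (0 : ℝ), g |u| :=
      setLIntegral_congr_fun measurableSet_Ioi fun u hu => by
        simp only [abs_of_pos (Set.mem_Ioi.1 hu)]
    rw [e, ← hmp]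
    simp only [hpre, abs_neg]

/-- The Riesz kernel `|u|^{-1/2}`. -/
def rieszHalf (u : ℝ) : ℝ≥0∞ := ENNReal.ofReal (|u| ^ (-(1 / 2) : ℝ))

lemma measurable_rieszHalf : Measurable rieszHalf := by
  unfold rieszHalf; fun_prop

lemma lintegral_rieszHalf_near {r : ℝ} (hr : 0 < r) :
    ∫⁻ u, (if |u| < r then rieszHalf u else 0) = ENNReal.ofReal (4 * r ^ (1 / 2 : ℝ)) := by
  have h := lintegral_comp_abs_eq
    (fun u => if u < r then ENNReal.ofReal (u ^ (-(1 / 2) : ℝ)) else 0)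
  change ∫⁻ u : ℝ, (if |u| < r then ENNReal.ofReal (|u| ^ (-(1 / 2) : ℝ)) else 0) = _
  rw [h]
  have e : ∀ u : ℝ, (if u < r then ENNReal.ofReal (u ^ (-(1 / 2) : ℝ)) else 0) =
      (Set.Iio r).indicator (fun u => ENNReal.ofReal (u ^ (-(1 / 2) : ℝ))) u := fun u => by
    simp [Set.indicator]
  simp only [e]
  rw [lintegral_indicator measurableSet_Iio, Measure.restrict_restrict measurableSet_Iio,
    Set.inter_comm, Set.Ioi_inter_Iio, setLIntegral_congr Ioo_ae_eq_Ioc]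
  have hi := (intervalIntegral.intervalIntegrable_rpow' (a := 0) (b := r)
    (r := (-(1 / 2) : ℝ)) (by norm_num))
  rw [intervalIntegrable_iff_integrableOn_Ioc_of_le hr.le] at hi
  rw [← ofReal_integral_eq_lintegral_ofReal hi, ← intervalIntegral.integral_of_le hr.le,
    integral_rpow_neg_half, Real.zero_rpow (by norm_num), sub_zero,
    show (2 : ℝ≥0∞) = ENNReal.ofReal 2 by simp, ← ENNReal.ofReal_mul (by norm_num)]
  · congr 1; ring
  · exact (ae_restrict_iff' measurableSet_Ioc).2
      (Filter.Eventually.of_forall fun u hu => Real.rpow_nonneg hu.1.le _)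

lemma lintegral_rieszHalf_far {r : ℝ} (hr : 0 < r) :
    ∫⁻ u, (if |u| < r then 0 else rieszHalf u) ^ (4 : ℝ) ≤ ENNReal.ofReal (2 * r⁻¹) := by
  have h := lintegral_comp_abs_eq
    (fun u => (if u < r then 0 else ENNReal.ofReal (u ^ (-(1 / 2) : ℝ))) ^ (4 : ℝ))
  change ∫⁻ u : ℝ, (if |u| < r then 0 else ENNReal.ofReal (|u| ^ (-(1 / 2) : ℝ))) ^ (4 : ℝ) ≤ _
  rw [h]
  have e : ∀ u : ℝ, (if u < r then 0 else ENNReal.ofReal (u ^ (-(1 / 2) : ℝ))) ^ (4 : ℝ) =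
      (Set.Ici r).indicator (fun u => ENNReal.ofReal (u ^ (-2 : ℝ))) u := fun u => by
    by_cases hu : u < r
    · simp [Set.indicator, hu, not_le.2 hu]
    · have hu' := not_lt.1 hu
      have h0 : 0 ≤ u := hr.le.trans hu'
      simp only [hu, if_false, Set.indicator, Set.mem_Ici, hu', if_true]
      rw [ENNReal.ofReal_rpow_of_nonneg (Real.rpow_nonneg h0 _) (by norm_num),
        ← Real.rpow_mul h0]
      norm_num
  simp only [e]
  rw [show (2 : ℝ≥0∞) = ENNReal.ofReal 2 by simp, ENNReal.ofReal_mul (by norm_num)]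
  gcongr
  refine (lintegral_mono' Measure.restrict_le_self le_rfl).trans ?_
  rw [lintegral_indicator measurableSet_Ici, setLIntegral_congr Ioi_ae_eq_Ici.symm,
    ← ofReal_integral_eq_lintegral_ofReal (integrableOn_Ioi_rpow_of_lt (by norm_num) hr),
    integral_Ioi_rpow_of_lt (by norm_num) hr]
  · norm_num
    rw [Real.rpow_neg_one]
  · exact (ae_restrict_iff' measurableSet_Ioi).2
      (Filter.Eventually.of_forall fun u hu => Real.rpow_nonneg (hr.le.trans (le_of_lt hu)) _)

/-- Pointwise bound for the part of a Riesz potential coming from smaller values. -/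
lemma lintegral_rieszHalf_mul_le {w : ℝ → ℝ≥0} (hw : Measurable w) {W : ℝ}
    (hW : ∫⁻ y, (w y : ℝ≥0∞) ^ (4 / 3 : ℝ) = ENNReal.ofReal W) (hW0 : 0 < W) (x : ℝ) {s : ℝ≥0}
    (hs : 0 < s) :
    ∫⁻ y, (if w y ≤ s then (w y : ℝ≥0∞) else 0) * rieszHalf (x - y) ≤
      ENNReal.ofReal (6 * W ^ (1 / 2 : ℝ) * (s : ℝ) ^ (1 / 3 : ℝ)) := by
  have hs' : 0 < (s : ℝ) := hs
  set r : ℝ := W * (s : ℝ) ^ (-(4 / 3) : ℝ) with hr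
  have hr0 : 0 < r := by positivity
  have hm := measurable_rieszHalf
  have hm1 : Measurable fun u => if |u| < r then rieszHalf u else 0 :=
    Measurable.ite (measurableSet_lt measurable_id.norm measurable_const) hm measurable_const
  have hm2 : Measurable fun u => if |u| < r then 0 else rieszHalf u :=
    Measurable.ite (measurableSet_lt measurable_id.norm measurable_const) measurable_const hm
  have step : ∀ y, (if w y ≤ s then (w y : ℝ≥0∞) else 0) * rieszHalf (x - y) ≤
      s * (if |x - y| < r then rieszHalf (x - y) else 0) +
        w y * (if |x - y| < r then 0 else rieszHalf (x - y)) := by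
    intro y
    by_cases h : |x - y| < r <;> by_cases h' : w y ≤ s <;> simp [h, h']
    gcongr
  have near : ∫⁻ y, (s : ℝ≥0∞) * (if |x - y| < r then rieszHalf (x - y) else 0) =
      s * ENNReal.ofReal (4 * r ^ (1 / 2 : ℝ)) := by
    rw [lintegral_const_mul' _ _ ENNReal.coe_ne_top]
    rw [lintegral_sub_left_eq_self (fun u => if |u| < r then rieszHalf u else 0) x,
      lintegral_rieszHalf_near hr0]
  have far : ∫⁻ y, (w y : ℝ≥0∞) * (if |x - y| < r then 0 else rieszHalf (x - y)) ≤
      ENNReal.ofReal W ^ (3 / 4 : ℝ) * ENNReal.ofReal (2 * r⁻¹) ^ (1 / 4 : ℝ) := by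
    have := ENNReal.lintegral_mul_le_Lp_mul_Lq volume (p := 4 / 3) (q := 4)
      (Real.holderConjugate_iff.2 ⟨by norm_num, by norm_num⟩)
      (f := fun y => (w y : ℝ≥0∞)) (g := fun y => if |x - y| < r then 0 else rieszHalf (x - y))
      hw.coe_nnreal_ennreal.aemeasurable
      (hm2.comp (measurable_const.sub measurable_id)).aemeasurable
    refine this.trans ?_
    rw [hW, lintegral_sub_left_eq_self
      (fun u => (if |u| < r then 0 else rieszHalf u) ^ (4 : ℝ)) x]
    norm_num
    gcongr
    simpa using lintegral_rieszHalf_far hr0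
  calc _ ≤ ∫⁻ y, (s : ℝ≥0∞) * (if |x - y| < r then rieszHalf (x - y) else 0) +
        w y * (if |x - y| < r then 0 else rieszHalf (x - y)) := lintegral_mono step
    _ = (∫⁻ y, (s : ℝ≥0∞) * (if |x - y| < r then rieszHalf (x - y) else 0)) +
        ∫⁻ y, w y * (if |x - y| < r then 0 else rieszHalf (x - y)) :=
        lintegral_add_left
          ((hm1.comp (measurable_const.sub measurable_id)).const_mul _) _
    _ ≤ s * ENNReal.ofReal (4 * r ^ (1 / 2 : ℝ)) +
        ENNReal.ofReal W ^ (3 / 4 : ℝ) * ENNReal.ofReal (2 * r⁻¹) ^ (1 / 4 : ℝ) :=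
        add_le_add near.le far
    _ ≤ _ := by
        rw [ENNReal.ofReal_rpow_of_nonneg hW0.le (by norm_num),
          ENNReal.ofReal_rpow_of_nonneg (by positivity) (by norm_num),
          show (s : ℝ≥0∞) = ENNReal.ofReal (s : ℝ) by simp,
          ← ENNReal.ofReal_mul (by positivity), ← ENNReal.ofReal_mul (by positivity),
          ← ENNReal.ofReal_add (by positivity) (by positivity)]
        refine ENNReal.ofReal_le_ofReal ?_
        have e1 : (s : ℝ) * (4 * r ^ (1 / 2 : ℝ)) =
            4 * (W ^ (1 / 2 : ℝ) * (s : ℝ) ^ (1 / 3 : ℝ)) := by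
          rw [hr, Real.mul_rpow hW0.le (by positivity), ← Real.rpow_mul hs'.le]
          have : (s : ℝ) ^ (1 / 3 : ℝ) = s * (s : ℝ) ^ (-(4 / 3) * (1 / 2) : ℝ) := by
            nth_rw 2 [← Real.rpow_one (s : ℝ)]
            rw [← Real.rpow_add hs']; norm_num
          rw [this]; ring
        have e2 : W ^ (3 / 4 : ℝ) * (2 * r⁻¹) ^ (1 / 4 : ℝ) =
            2 ^ (1 / 4 : ℝ) * (W ^ (1 / 2 : ℝ) * (s : ℝ) ^ (1 / 3 : ℝ)) := by
          rw [Real.mul_rpow (by norm_num) (by positivity), hr, mul_inv,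
            Real.mul_rpow (by positivity) (by positivity), ← Real.rpow_neg hs'.le,
            ← Real.rpow_neg_one W, ← Real.rpow_mul hW0.le, ← Real.rpow_mul hs'.le]
          have : W ^ (1 / 2 : ℝ) = W ^ (3 / 4 : ℝ) * W ^ (-1 * (1 / 4) : ℝ) := by
            rw [← Real.rpow_add hW0]; norm_num
          rw [this]; norm_num; ring
        have e3 : (2 : ℝ) ^ (1 / 4 : ℝ) ≤ 2 := by
          calc (2 : ℝ) ^ (1 / 4 : ℝ) ≤ 2 ^ (1 : ℝ) :=
                Real.rpow_le_rpow_of_exponent_le (by norm_num) (by norm_num)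
            _ = 2 := Real.rpow_one 2
        rw [e1, e2]
        nlinarith [mul_nonneg (Real.rpow_nonneg hW0.le (1 / 2 : ℝ))
          (Real.rpow_nonneg hs'.le (1 / 3 : ℝ))]

/-- Hardy–Littlewood–Sobolev inequality on the diagonal, with kernel `|x - y|^{-1/2}`. -/
lemma lintegral_rieszHalf_bilinear_le {w : ℝ → ℝ≥0} (hw : Measurable w) :
    ∫⁻ x, ∫⁻ y, (w x : ℝ≥0∞) * w y * rieszHalf (x - y) ≤
      12 * (∫⁻ y, (w y : ℝ≥0∞) ^ (4 / 3 : ℝ)) ^ (3 / 2 : ℝ) := by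
  have hm := measurable_rieszHalf
  by_cases htop : ∫⁻ y, (w y : ℝ≥0∞) ^ (4 / 3 : ℝ) = ∞
  · rw [htop]; norm_num
  by_cases hzero : ∫⁻ y, (w y : ℝ≥0∞) ^ (4 / 3 : ℝ) = 0
  · have h0 : ∀ᵐ y, (w y : ℝ≥0∞) = 0 := by
      have := (lintegral_eq_zero_iff (hw.coe_nnreal_ennreal.pow_const _)).1 hzero
      filter_upwards [this] with y hy
      simpa using hy
    have : ∫⁻ x, ∫⁻ y, (w x : ℝ≥0∞) * w y * rieszHalf (x - y) = 0 := by
      rw [lintegral_congr_ae (g := fun _ => 0) ?_, lintegral_zero]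
      filter_upwards [h0] with x hx
      simp [hx]
    rw [this]; exact zero_le
  set W := (∫⁻ y, (w y : ℝ≥0∞) ^ (4 / 3 : ℝ)).toReal with hWdef
  have hW : ∫⁻ y, (w y : ℝ≥0∞) ^ (4 / 3 : ℝ) = ENNReal.ofReal W := (ENNReal.ofReal_toReal htop).symm
  have hW0 : 0 < W := ENNReal.toReal_pos hzero htop
  set T : ℝ → ℝ → ℝ≥0∞ := fun x y =>
    w x * ((if w y ≤ w x then (w y : ℝ≥0∞) else 0) * rieszHalf (x - y)) with hT
  have hTm : Measurable (Function.uncurry T) := by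
    refine (hw.comp measurable_fst).coe_nnreal_ennreal.mul (Measurable.mul ?_ ?_)
    · exact Measurable.ite (measurableSet_le (hw.comp measurable_snd) (hw.comp measurable_fst))
        (hw.comp measurable_snd).coe_nnreal_ennreal measurable_const
    · exact hm.comp (measurable_fst.sub measurable_snd)
  have hsum : ∀ x y, (w x : ℝ≥0∞) * w y * rieszHalf (x - y) ≤ T x y + T y x := by
    intro x y
    have hsymm : rieszHalf (y - x) = rieszHalf (x - y) := by
      unfold rieszHalf; rw [abs_sub_comm]
    rcases le_total (w y) (w x) with h | h
    · refine le_trans ?_ le_self_add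
      simp [hT, h, mul_assoc]
    · refine le_trans ?_ le_add_self
      simp only [hT, h, if_true, hsymm]
      rw [mul_comm (w x : ℝ≥0∞), mul_assoc]
  have hone : ∫⁻ x, ∫⁻ y, T x y ≤ 6 * ENNReal.ofReal W ^ (3 / 2 : ℝ) := by
    have : ∀ x, ∫⁻ y, T x y ≤
        ENNReal.ofReal (6 * W ^ (1 / 2 : ℝ)) * (w x : ℝ≥0∞) ^ (4 / 3 : ℝ) := by
      intro x
      simp only [hT]
      rw [lintegral_const_mul' _ _ ENNReal.coe_ne_top]
      rcases eq_or_lt_of_le (zero_le : 0 ≤ w x) with h | h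
      · rw [← h]; simp
      · refine (mul_le_mul_right (lintegral_rieszHalf_mul_le hw hW hW0 x h) _).trans_eq ?_
        rw [ENNReal.ofReal_mul (by positivity), ← ENNReal.ofReal_rpow_of_nonneg (by positivity)
          (by norm_num), ENNReal.ofReal_coe_nnreal, mul_left_comm]
        congr 1
        nth_rw 1 [← ENNReal.rpow_one (w x : ℝ≥0∞)]
        rw [← ENNReal.rpow_add _ _ (by exact_mod_cast h.ne') ENNReal.coe_ne_top]
        norm_num
    refine (lintegral_mono this).trans_eq ?_
    rw [lintegral_const_mul' _ _ ENNReal.ofReal_ne_top, hW, ENNReal.ofReal_mul (by norm_num),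
      ← ENNReal.ofReal_rpow_of_pos hW0, mul_assoc]
    congr 1
    · norm_num
    · nth_rw 2 [← ENNReal.rpow_one (ENNReal.ofReal W)]
      rw [← ENNReal.rpow_add _ _ (by simpa using hW0) ENNReal.ofReal_ne_top]
      norm_num
  have hswap : ∫⁻ x, ∫⁻ y, T y x = ∫⁻ x, ∫⁻ y, T x y :=
    lintegral_lintegral_swap (hTm.comp measurable_swap).aemeasurable
  calc _ ≤ ∫⁻ x, ∫⁻ y, (T x y + T y x) := lintegral_mono fun x => lintegral_mono (hsum x)
    _ = ∫⁻ x, ((∫⁻ y, T x y) + ∫⁻ y, T y x) := lintegral_congr fun x =>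
        lintegral_add_left (hTm.comp measurable_prodMk_left) _
    _ = (∫⁻ x, ∫⁻ y, T x y) + ∫⁻ x, ∫⁻ y, T y x :=
        lintegral_add_left hTm.lintegral_prod_right' _
    _ ≤ 6 * ENNReal.ofReal W ^ (3 / 2 : ℝ) + 6 * ENNReal.ofReal W ^ (3 / 2 : ℝ) := by
        rw [hswap]; exact add_le_add hone hone
    _ = 12 * (∫⁻ y, (w y : ℝ≥0∞) ^ (4 / 3 : ℝ)) ^ (3 / 2 : ℝ) := by
        rw [hW, ← add_mul]; norm_num

/-- The `TT*` argument: a pointwise kernel bound controls the adjoint operator. -/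
lemma lintegral_adjoint_sq_le {k : ℝ → ℝ → ℂ} (hk : Measurable (Function.uncurry k))
    {S : Set ℝ} (hS : MeasurableSet S) (hSv : volume S ≠ ∞)
    (hk1 : ∀ x ξ, ‖k x ξ‖ ≤ S.indicator 1 ξ) {C : ℝ} (hC : 0 ≤ C)
    (hker : ∀ x y, x ≠ y → ‖∫ ξ, k x ξ * (starRingEnd ℂ) (k y ξ)‖ ≤ C * |x - y| ^ (-(1 / 2) : ℝ))
    {w : ℝ → ℂ} (hwm : Measurable w) (hw : Integrable w) :
    ∫⁻ ξ, ‖∫ x, k x ξ * w x‖ₑ ^ 2 ≤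
      ENNReal.ofReal C * (12 * (∫⁻ x, ‖w x‖ₑ ^ (4 / 3 : ℝ)) ^ (3 / 2 : ℝ)) := by
  set H : ℝ → ℂ := fun ξ => ∫ x, k x ξ * w x with hH
  have hind : Integrable (S.indicator (1 : ℝ → ℝ)) :=
    (integrable_indicator_iff hS).2 (integrableOn_const (hs := hSv))
  have hi1 : ∀ ξ, S.indicator (1 : ℝ → ℝ) ξ ≤ 1 := fun ξ =>
    Set.indicator_le_self' (fun _ _ => zero_le_one) ξ
  set Φ : ℝ → ℝ × ℝ → ℂ := fun ξ p =>
    (k p.1 ξ * w p.1) * (starRingEnd ℂ) (k p.2 ξ * w p.2) with hΦ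
  have hΦm : Measurable (Function.uncurry Φ) := by
    have m1 : Measurable fun q : ℝ × ℝ × ℝ => k q.2.1 q.1 :=
      hk.comp ((measurable_fst.comp measurable_snd).prodMk measurable_fst)
    have m2 : Measurable fun q : ℝ × ℝ × ℝ => k q.2.2 q.1 :=
      hk.comp ((measurable_snd.comp measurable_snd).prodMk measurable_fst)
    exact (m1.mul (hwm.comp (measurable_fst.comp measurable_snd))).mul
      (Complex.continuous_conj.measurable.comp
        (m2.mul (hwm.comp (measurable_snd.comp measurable_snd))))
  have hww : Integrable (fun p : ℝ × ℝ => ‖w p.1‖ * ‖w p.2‖) := hw.norm.mul_prod hw.norm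
  have hΦi : Integrable (Function.uncurry Φ) (volume.prod volume) := by
    refine (hind.mul_prod hww).mono' hΦm.aestronglyMeasurable
      (Filter.Eventually.of_forall fun q => ?_)
    simp only [Function.uncurry, hΦ, norm_mul, RCLike.norm_conj]
    have a1 := hk1 q.2.1 q.1
    have a2 := (hk1 q.2.2 q.1).trans (hi1 _)
    have : ‖k q.2.1 q.1‖ * ‖k q.2.2 q.1‖ ≤ S.indicator 1 q.1 :=
      (mul_le_mul a1 a2 (norm_nonneg _) ((norm_nonneg _).trans a1)).trans_eq (mul_one _)
    calc _ = (‖k q.2.1 q.1‖ * ‖k q.2.2 q.1‖) * (‖w q.2.1‖ * ‖w q.2.2‖) := by ring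
      _ ≤ _ := by gcongr
  have hHH : ∀ ξ, ((‖H ξ‖ ^ 2 : ℝ) : ℂ) = ∫ p, Φ ξ p := by
    intro ξ
    rw [Complex.ofReal_pow, ← Complex.mul_conj', hH]
    simp only
    rw [← integral_conj]
    exact (integral_prod_mul _ _).symm
  have hHint : Integrable fun ξ => ‖H ξ‖ ^ 2 := by
    have := hΦi.integral_prod_left
    have h2 : Integrable fun ξ => ((‖H ξ‖ ^ 2 : ℝ) : ℂ) := by
      simp only [hHH]; exact this
    exact h2.re
  have e0 : ∫⁻ ξ, ‖H ξ‖ₑ ^ 2 = ‖∫ ξ, ∫ p, Φ ξ p‖ₑ := by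
    simp only [← hHH]
    rw [integral_complex_ofReal, ← ofReal_norm, Complex.norm_real, Real.norm_eq_abs,
      abs_of_nonneg (integral_nonneg fun ξ => by positivity),
      ofReal_integral_eq_lintegral_ofReal hHint
        (Filter.Eventually.of_forall fun ξ => by positivity)]
    refine lintegral_congr fun ξ => ?_
    rw [ENNReal.ofReal_pow (norm_nonneg _), ofReal_norm]
  have hpt : ∀ x y, x ≠ y → ‖∫ ξ, Φ ξ (x, y)‖ₑ ≤
      ENNReal.ofReal C * (‖w x‖ₑ * ‖w y‖ₑ * rieszHalf (x - y)) := by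
    intro x y hxy
    have : ∀ ξ, Φ ξ (x, y) = (w x * (starRingEnd ℂ) (w y)) *
        (k x ξ * (starRingEnd ℂ) (k y ξ)) := fun ξ => by
      simp only [hΦ, map_mul]; ring
    simp only [this]
    rw [integral_const_mul, enorm_mul, enorm_mul, RCLike.enorm_conj]
    have h3 : ‖∫ ξ, k x ξ * (starRingEnd ℂ) (k y ξ)‖ₑ ≤ ENNReal.ofReal C * rieszHalf (x - y) := by
      rw [← ofReal_norm, rieszHalf, ← ENNReal.ofReal_mul hC]
      exact ENNReal.ofReal_le_ofReal (hker x y hxy)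
    calc _ ≤ ‖w x‖ₑ * ‖w y‖ₑ * (ENNReal.ofReal C * rieszHalf (x - y)) := by gcongr
      _ = _ := by ring
  rw [e0, integral_integral_swap hΦi]
  refine (enorm_integral_le_lintegral_enorm _).trans ?_
  rw [Measure.volume_eq_prod]
  refine (lintegral_prod_le _).trans ?_
  calc _ ≤ ∫⁻ x, ∫⁻ y, ENNReal.ofReal C * (‖w x‖ₑ * ‖w y‖ₑ * rieszHalf (x - y)) := by
        refine lintegral_mono fun x => lintegral_mono_ae ?_
        have : ∀ᵐ y : ℝ, y ≠ x := by
          simp [ae_iff]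
        filter_upwards [this] with y hy
        exact hpt x y hy.symm
    _ = ENNReal.ofReal C * ∫⁻ x, ∫⁻ y, ‖w x‖ₑ * ‖w y‖ₑ * rieszHalf (x - y) := by
        simp only [lintegral_const_mul' _ _ ENNReal.ofReal_ne_top]
    _ ≤ _ := by
        gcongr
        exact lintegral_rieszHalf_bilinear_le (w := fun x => ‖w x‖₊) hwm.nnnorm

/-- Linearised maximal estimate `L² → L⁴` from a kernel bound `|x - y|^{-1/2}`. -/
lemma lintegral_pow_four_le_of_kernel {k : ℝ → ℝ → ℂ} (hk : Measurable (Function.uncurry k))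
    {S : Set ℝ} (hS : MeasurableSet S) (hSv : volume S ≠ ∞)
    (hk1 : ∀ x ξ, ‖k x ξ‖ ≤ S.indicator 1 ξ) {C : ℝ} (hC : 0 ≤ C)
    (hker : ∀ x y, x ≠ y → ‖∫ ξ, k x ξ * (starRingEnd ℂ) (k y ξ)‖ ≤ C * |x - y| ^ (-(1 / 2) : ℝ))
    {g : ℝ → ℂ} (hgm : Measurable g) (hg : Integrable g) :
    ∫⁻ x, ‖∫ ξ, k x ξ * g ξ‖ₑ ^ 4 ≤ (12 * ENNReal.ofReal C * ∫⁻ ξ, ‖g ξ‖ₑ ^ 2) ^ 2 := by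
  set V : ℝ → ℂ := fun x => ∫ ξ, k x ξ * g ξ with hV
  have hVm : Measurable V := by
    have : StronglyMeasurable (Function.uncurry fun x ξ => k x ξ * g ξ) :=
      (hk.mul (hgm.comp measurable_snd)).stronglyMeasurable
    exact this.integral_prod_right.measurable
  have hk1' : ∀ x ξ, ‖k x ξ‖ ≤ 1 := fun x ξ => (hk1 x ξ).trans
    (Set.indicator_le_self' (fun _ _ => zero_le_one) ξ)
  have hVb : ∀ x, ‖V x‖ ≤ ∫ ξ, ‖g ξ‖ := fun x => by
    refine norm_integral_le_of_norm_le hg.norm (Filter.Eventually.of_forall fun ξ => ?_)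
    rw [norm_mul]
    exact (mul_le_mul_of_nonneg_right (hk1' x ξ) (norm_nonneg _)).trans_eq (one_mul _)
  set G := ∫ ξ, ‖g ξ‖
  have hG0 : 0 ≤ G := integral_nonneg fun _ => norm_nonneg _
  set N2 := ∫⁻ ξ, ‖g ξ‖ₑ ^ 2
  have loc : ∀ n : ℕ, ∫⁻ x in Set.Icc (-(n : ℝ)) n, ‖V x‖ₑ ^ 4 ≤
      (12 * ENNReal.ofReal C * N2) ^ 2 := by
    intro n
    set J := Set.Icc (-(n : ℝ)) n with hJ
    have hJm : MeasurableSet J := measurableSet_Icc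
    set w : ℝ → ℂ := J.indicator fun x => (starRingEnd ℂ) (V x) * ((‖V x‖ ^ 2 : ℝ) : ℂ) with hw
    have hwm : Measurable w := Measurable.indicator
      ((Complex.continuous_conj.measurable.comp hVm).mul
        (Complex.measurable_ofReal.comp (hVm.norm.pow_const 2))) hJm
    have hwi : Integrable w := by
      refine (integrable_indicator_iff hJm).2 (IntegrableOn.of_bound (C := G ^ 3) ?_ ?_ ?_)
      · exact measure_Icc_lt_top
      · exact ((Complex.continuous_conj.measurable.comp hVm).mul
          (Complex.measurable_ofReal.comp (hVm.norm.pow_const 2))).aestronglyMeasurable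
      · refine Filter.Eventually.of_forall fun x => ?_
        rw [norm_mul, RCLike.norm_conj, Complex.norm_real, Real.norm_eq_abs,
          abs_of_nonneg (by positivity)]
        calc ‖V x‖ * ‖V x‖ ^ 2 = ‖V x‖ ^ 3 := by ring
          _ ≤ G ^ 3 := by gcongr; exact hVb x
    set I := ∫⁻ x in J, ‖V x‖ₑ ^ 4 with hI
    have hIfin : I ≠ ∞ := by
      refine (lt_of_le_of_lt (b := ∫⁻ x in J, ENNReal.ofReal G ^ 4) ?_ ?_).ne
      · refine lintegral_mono fun x => ?_
        gcongr
        rw [← ofReal_norm]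
        exact ENNReal.ofReal_le_ofReal (hVb x)
      · rw [setLIntegral_const]
        exact ENNReal.mul_lt_top (by simp) measure_Icc_lt_top
    have hVw : ∀ x, V x * w x = J.indicator (fun x => ((‖V x‖ ^ 4 : ℝ) : ℂ)) x := by
      intro x
      by_cases hx : x ∈ J
      · simp only [hw, Set.indicator_of_mem hx, ← mul_assoc, Complex.mul_conj']
        push_cast; ring
      · simp [hw, Set.indicator_of_notMem hx]
    have lhs : ‖∫ x, V x * w x‖ₑ = I := by
      simp only [hVw]
      rw [integral_indicator hJm, integral_complex_ofReal, ← ofReal_norm,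
        Complex.norm_real, Real.norm_eq_abs,
        abs_of_nonneg (integral_nonneg fun x => by positivity),
        integral_eq_lintegral_of_nonneg_ae (Filter.Eventually.of_forall fun x => by positivity)
          (hVm.norm.pow_const 4).aestronglyMeasurable]
      have : ∀ x, ENNReal.ofReal (‖V x‖ ^ 4) = ‖V x‖ₑ ^ 4 := fun x => by
        rw [ENNReal.ofReal_pow (norm_nonneg _), ofReal_norm]
      simp only [this]
      exact ENNReal.ofReal_toReal hIfin
    have hw43 : ∫⁻ x, ‖w x‖ₑ ^ (4 / 3 : ℝ) = I := by
      rw [hI, ← lintegral_indicator hJm]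
      refine lintegral_congr fun x => ?_
      by_cases hx : x ∈ J
      · simp only [hw, Set.indicator_of_mem hx]
        rw [enorm_mul, RCLike.enorm_conj]
        have : ‖((‖V x‖ ^ 2 : ℝ) : ℂ)‖ₑ = ‖V x‖ₑ ^ 2 := by
          rw [← ofReal_norm, Complex.norm_real, Real.norm_eq_abs,
            abs_of_nonneg (by positivity), ENNReal.ofReal_pow (norm_nonneg _),
            ofReal_norm]
        rw [this, ← pow_succ', ← ENNReal.rpow_natCast, ← ENNReal.rpow_natCast, ← ENNReal.rpow_mul]
        norm_num
      · simp [hw, Set.indicator_of_notMem hx]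
    have swap : ∫ x, V x * w x = ∫ ξ, g ξ * ∫ x, k x ξ * w x := by
      have hi : Integrable (Function.uncurry fun x ξ => k x ξ * g ξ * w x)
          (volume.prod volume) := by
        refine (hwi.norm.mul_prod hg.norm).mono' ?_ (Filter.Eventually.of_forall fun q => ?_)
        · exact ((hk.mul (hgm.comp measurable_snd)).mul
            (hwm.comp measurable_fst)).aestronglyMeasurable
        · simp only [Function.uncurry, norm_mul]
          calc _ = ‖k q.1 q.2‖ * (‖w q.1‖ * ‖g q.2‖) := by ring
            _ ≤ 1 * (‖w q.1‖ * ‖g q.2‖) := by gcongr; exact hk1' _ _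
            _ = _ := one_mul _
      simp only [hV, ← integral_mul_const, ← integral_const_mul]
      rw [integral_integral_swap hi]
      refine integral_congr_ae (Filter.Eventually.of_forall fun ξ => ?_)
      refine integral_congr_ae (Filter.Eventually.of_forall fun x => ?_)
      simp only; ring
    have hHm : Measurable fun ξ => ∫ x, k x ξ * w x := by
      have : StronglyMeasurable (Function.uncurry fun ξ x => k x ξ * w x) :=
        ((hk.comp measurable_swap).mul (hwm.comp measurable_snd)).stronglyMeasurable
      exact this.integral_prod_right.measurable
    have cs : I ≤ N2 ^ (1 / 2 : ℝ) * (∫⁻ ξ, ‖∫ x, k x ξ * w x‖ₑ ^ 2) ^ (1 / 2 : ℝ) := by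
      rw [← lhs, swap]
      refine (enorm_integral_le_lintegral_enorm _).trans ?_
      have := ENNReal.lintegral_mul_le_Lp_mul_Lq volume Real.HolderConjugate.two_two
        (f := fun ξ => ‖g ξ‖ₑ) (g := fun ξ => ‖∫ x, k x ξ * w x‖ₑ)
        hgm.enorm.aemeasurable hHm.enorm.aemeasurable
      simp only [enorm_mul]
      simpa using this
    have adj := lintegral_adjoint_sq_le hk hS hSv hk1 hC hker hwm hwi
    rw [hw43] at adj
    by_cases hI0 : I = 0
    · rw [hI0]; exact zero_le
    have cs2 : I ^ 2 ≤ (12 * ENNReal.ofReal C * N2) * I ^ (3 / 2 : ℝ) := by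
      calc I ^ 2 ≤ (N2 ^ (1 / 2 : ℝ) * (∫⁻ ξ, ‖∫ x, k x ξ * w x‖ₑ ^ 2) ^ (1 / 2 : ℝ)) ^ 2 := by
            gcongr
        _ = N2 * ∫⁻ ξ, ‖∫ x, k x ξ * w x‖ₑ ^ 2 := by
            rw [mul_pow, ← ENNReal.rpow_natCast, ← ENNReal.rpow_natCast, ← ENNReal.rpow_mul,
              ← ENNReal.rpow_mul]
            norm_num
        _ ≤ N2 * (ENNReal.ofReal C * (12 * I ^ (3 / 2 : ℝ))) := by gcongr
        _ = _ := by ring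
    have hI1 : I ^ (1 / 2 : ℝ) ≤ 12 * ENNReal.ofReal C * N2 := by
      have hne : I ^ (3 / 2 : ℝ) ≠ 0 := by simp [ENNReal.rpow_eq_zero_iff, hI0, hIfin]
      have hne' : I ^ (3 / 2 : ℝ) ≠ ∞ := ENNReal.rpow_ne_top_of_nonneg (by norm_num) hIfin
      have e : I ^ 2 = I ^ (1 / 2 : ℝ) * I ^ (3 / 2 : ℝ) := by
        rw [← ENNReal.rpow_add _ _ hI0 hIfin, ← ENNReal.rpow_natCast]; norm_num
      rw [e] at cs2
      exact (ENNReal.mul_le_mul_iff_left hne hne').1 cs2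
    calc I = (I ^ (1 / 2 : ℝ)) ^ 2 := by
          rw [← ENNReal.rpow_natCast, ← ENNReal.rpow_mul]; norm_num
      _ ≤ _ := by gcongr
  have hun : ⋃ n : ℕ, Set.Icc (-(n : ℝ)) n = Set.univ := by
    refine Set.eq_univ_of_forall fun x => Set.mem_iUnion.2 ?_
    obtain ⟨n, hn⟩ := exists_nat_ge |x|
    exact ⟨n, abs_le.1 hn⟩
  have hmono : Monotone fun n : ℕ => Set.Icc (-(n : ℝ)) n := fun m n h => by
    have : (m : ℝ) ≤ n := by exact_mod_cast h
    exact Set.Icc_subset_Icc (by linarith) this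
  rw [← setLIntegral_univ, ← hun, setLIntegral_iUnion_of_directed _ hmono.directed_le]
  exact iSup_le loc

/-- The kernel of `D_x^{-1/4} S(t)` truncated to the band `a ≤ |ξ| < k`. -/
def truncKernel (ν μ x t k ξ : ℝ) : ℂ :=
  if aconst ν μ ≤ |ξ| ∧ |ξ| < k then
    ((|ξ| ^ (-(1 / 4) : ℝ) : ℝ) : ℂ) * planeWave ν μ x t ξ else 0

lemma norm_truncKernel_le_one (ν μ x t k ξ : ℝ) : ‖truncKernel ν μ x t k ξ‖ ≤ 1 := by
  unfold truncKernel
  split_ifs with h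
  · have h2 := two_le_aconst ν μ
    rw [norm_mul, norm_planeWave, mul_one, Complex.norm_real, Real.norm_eq_abs,
      abs_of_nonneg (by positivity)]
    exact Real.rpow_le_one_of_one_le_of_nonpos (by linarith [h.1]) (by norm_num)
  · simp

lemma measurable_truncKernel {ν μ : ℝ} {α : Type*} [MeasurableSpace α] {x t k ξ : α → ℝ}
    (hx : Measurable x) (ht : Measurable t) (hk : Measurable k) (hξ : Measurable ξ) :
    Measurable fun p => truncKernel ν μ (x p) (t p) (k p) (ξ p) := by
  unfold truncKernel
  refine Measurable.ite ((measurableSet_le measurable_const hξ.norm).inter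
    (measurableSet_lt hξ.norm hk)) ?_ measurable_const
  refine (Complex.measurable_ofReal.comp (hξ.norm.pow_const _)).mul ?_
  exact (continuous_planeWave ν μ).measurable.comp (hx.prodMk (ht.prodMk hξ))

/-- `D_x^{-1/4} S(t)` applied to the part of the data with Fourier transform `g` and frequencies in
`a ≤ |ξ| < k`. -/
def truncWave (ν μ : ℝ) (g : ℝ → ℂ) (x t k : ℝ) : ℂ := ∫ ξ, truncKernel ν μ x t k ξ * g ξ

lemma measurable_truncWave {ν μ : ℝ} {g : ℝ → ℂ} (hg : Measurable g) {t k : ℝ → ℝ}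
    (ht : Measurable t) (hk : Measurable k) :
    Measurable fun x => truncWave ν μ g x (t x) (k x) := by
  have : StronglyMeasurable
      (Function.uncurry fun x ξ => truncKernel ν μ x (t x) (k x) ξ * g ξ) :=
    ((measurable_truncKernel measurable_fst (ht.comp measurable_fst) (hk.comp measurable_fst)
      measurable_snd).mul (hg.comp measurable_snd)).stronglyMeasurable
  exact this.integral_prod_right.measurable

lemma truncKernel_mul_conj (ν μ x t k y s l ξ : ℝ) :
    truncKernel ν μ x t k ξ * (starRingEnd ℂ) (truncKernel ν μ y s l ξ) =
      (freqBand (aconst ν μ) (min k l)).indicator (fun ξ =>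
        ((|ξ| ^ (-(1 / 2) : ℝ) : ℝ) : ℂ) * planeWave ν μ (x - y) (t - s) ξ) ξ := by
  have hband : ξ ∈ freqBand (aconst ν μ) (min k l) ↔
      (aconst ν μ ≤ |ξ| ∧ |ξ| < k) ∧ (aconst ν μ ≤ |ξ| ∧ |ξ| < l) := by
    simp only [freqBand, Set.mem_ofPred_eq, lt_min_iff]; tauto
  rw [Set.indicator_apply]
  simp only [hband, truncKernel]
  by_cases h1 : aconst ν μ ≤ |ξ| ∧ |ξ| < k
  swap
  · rw [if_neg h1, zero_mul, if_neg (fun h => h1 h.1)]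
  by_cases h2 : aconst ν μ ≤ |ξ| ∧ |ξ| < l
  swap
  · rw [if_neg h2, map_zero, mul_zero, if_neg (fun h => h2 h.2)]
  rw [if_pos h1, if_pos h2, if_pos ⟨h1, h2⟩]
  have hξ : 0 < |ξ| := by linarith [h1.1, two_le_aconst ν μ]
  rw [map_mul, Complex.conj_ofReal, ← planeWave_mul_conj]
  have : |ξ| ^ (-(1 / 2) : ℝ) = |ξ| ^ (-(1 / 4) : ℝ) * |ξ| ^ (-(1 / 4) : ℝ) := by
    rw [← Real.rpow_add hξ]; norm_num
  rw [this]; push_cast; ring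

/-- Maximal estimate for measurably chosen times and truncations. -/
lemma lintegral_truncWave_linearized_le {ν μ : ℝ} (hμ : μ ≠ 0) {g : ℝ → ℂ} (hgm : Measurable g)
    (hg : Integrable g) {t k : ℝ → ℝ} (ht : Measurable t) (hk : Measurable k) {B : ℝ}
    (hB : ∀ x, k x ≤ B) :
    ∫⁻ x, ‖truncWave ν μ g x (t x) (k x)‖ₑ ^ 4 ≤ (720 * ∫⁻ ξ, ‖g ξ‖ₑ ^ 2) ^ 2 := by
  have hvol : volume (freqBand (aconst ν μ) B) ≠ ∞ := by
    refine ((measure_mono (t := Set.Icc (-B) B) ?_).trans_lt measure_Icc_lt_top).ne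
    exact fun ξ hξ => abs_le.1 hξ.2.le
  have := lintegral_pow_four_le_of_kernel
    (k := fun x ξ => truncKernel ν μ x (t x) (k x) ξ)
    (measurable_truncKernel measurable_fst (ht.comp measurable_fst) (hk.comp measurable_fst)
      measurable_snd) (measurableSet_freqBand (aconst ν μ) B) hvol (fun x ξ => ?_)
    (C := 60) (by norm_num) (fun x y hxy => ?_) hgm hg
  · refine this.trans_eq ?_
    congr 2
    rw [ENNReal.ofReal_ofNat]; norm_num
  · by_cases h : ξ ∈ freqBand (aconst ν μ) B
    · rw [Set.indicator_of_mem h]; exact norm_truncKernel_le_one _ _ _ _ _ _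
    · have : ¬(aconst ν μ ≤ |ξ| ∧ |ξ| < k x) := fun h' => h ⟨h'.1, h'.2.trans_le (hB x)⟩
      simp [truncKernel, this, Set.indicator_of_notMem h]
  · simp only [truncKernel_mul_conj]
    rw [integral_indicator (measurableSet_freqBand _ _)]
    exact norm_setIntegral_freqBand_le hμ _ _ (sub_ne_zero.2 hxy)

/-- A measurable selection of the largest among finitely many truncated waves. -/
lemma exists_measurable_argmax {ν μ : ℝ} {g : ℝ → ℂ} (hgm : Measurable g) (p : ℕ → ℝ × ℝ) (n : ℕ) :
    ∃ t k : ℝ → ℝ, ∃ B : ℝ, Measurable t ∧ Measurable k ∧ (∀ x, k x ≤ B) ∧ ∀ x, ∀ j ≤ n,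
      ‖truncWave ν μ g x (p j).1 (p j).2‖ₑ ≤ ‖truncWave ν μ g x (t x) (k x)‖ₑ := by
  induction n with
  | zero =>
    refine ⟨fun _ => (p 0).1, fun _ => (p 0).2, (p 0).2, measurable_const, measurable_const,
      fun _ => le_rfl, fun x j hj => ?_⟩
    rw [Nat.le_zero.1 hj]
  | succ n ih =>
    obtain ⟨t, k, B, ht, hk, hB, h⟩ := ih
    set s : Set ℝ := {x | ‖truncWave ν μ g x (t x) (k x)‖ₑ <
      ‖truncWave ν μ g x (p (n + 1)).1 (p (n + 1)).2‖ₑ} with hs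
    have hsm : MeasurableSet s := measurableSet_lt (measurable_truncWave hgm ht hk).enorm
      (measurable_truncWave hgm measurable_const measurable_const).enorm
    refine ⟨fun x => if x ∈ s then (p (n + 1)).1 else t x,
      fun x => if x ∈ s then (p (n + 1)).2 else k x, max B (p (n + 1)).2,
      Measurable.ite hsm measurable_const ht, Measurable.ite hsm measurable_const hk,
      fun x => ?_, fun x j hj => ?_⟩
    · dsimp only
      split_ifs
      · exact le_max_right _ _
      · exact (hB x).trans (le_max_left _ _)
    · by_cases hx : x ∈ s
      · simp only [hx, if_true]
        rcases Nat.le_succ_iff.1 hj with hj | rfl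
        · exact (h x j hj).trans (le_of_lt hx)
        · exact le_rfl
      · simp only [hx, if_false]
        rcases Nat.le_succ_iff.1 hj with hj | rfl
        · exact h x j hj
        · exact not_lt.1 hx

/-- The maximal function over times and frequency truncations. -/
def maxWave (ν μ : ℝ) (g : ℝ → ℂ) (x : ℝ) : ℝ≥0∞ :=
  ⨆ j : ℕ, ‖truncWave ν μ g x (TopologicalSpace.denseSeq (ℝ × ℝ) j).1
    (TopologicalSpace.denseSeq (ℝ × ℝ) j).2‖ₑ

/-- The maximal function estimate `L² → L⁴_x`. -/
lemma lintegral_maxWave_le {ν μ : ℝ} (hμ : μ ≠ 0) {g : ℝ → ℂ} (hgm : Measurable g)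
    (hg : Integrable g) :
    ∫⁻ x, maxWave ν μ g x ^ 4 ≤ (720 * ∫⁻ ξ, ‖g ξ‖ₑ ^ 2) ^ 2 := by
  set p := TopologicalSpace.denseSeq (ℝ × ℝ)
  set f : ℕ → ℝ → ℝ≥0∞ := fun j x => ‖truncWave ν μ g x (p j).1 (p j).2‖ₑ with hf
  have hfm : ∀ j, Measurable (f j) := fun j =>
    (measurable_truncWave hgm measurable_const measurable_const).enorm
  have hsup : ∀ x, maxWave ν μ g x ^ 4 = ⨆ n, (⨆ j, ⨆ _ : j ≤ n, f j x) ^ 4 := by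
    intro x
    have e : maxWave ν μ g x = ⨆ n, ⨆ j, ⨆ _ : j ≤ n, f j x := by
      refine le_antisymm (iSup_le fun j => ?_) (iSup_le fun n => iSup₂_le fun j _ => ?_)
      · exact le_iSup_of_le j (le_iSup₂_of_le j le_rfl le_rfl)
      · exact le_iSup (fun j => f j x) j
    rw [e]
    have : (fun y : ℝ≥0∞ => y ^ 4) = fun y => y ^ (4 : ℝ) := by
      ext y; rw [← ENNReal.rpow_natCast]; norm_num
    change (fun y : ℝ≥0∞ => y ^ 4) _ = ⨆ n, (fun y : ℝ≥0∞ => y ^ 4) _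
    rw [this]
    exact (ENNReal.orderIsoRpow 4 (by norm_num)).map_iSup _
  simp only [hsup]
  rw [lintegral_iSup]
  · refine iSup_le fun n => ?_
    obtain ⟨t, k, B, ht, hk, hB, h⟩ := exists_measurable_argmax (ν := ν) (μ := μ) hgm p n
    refine le_trans (lintegral_mono fun x => ?_)
      (lintegral_truncWave_linearized_le (ν := ν) hμ hgm hg ht hk hB)
    gcongr
    exact iSup₂_le fun j hj => h x j hj
  · exact fun n => (Measurable.iSup fun j => Measurable.iSup fun _ => hfm j).pow_const 4
  · intro m n hmn x
    refine pow_le_pow_left' (iSup₂_le fun j (hj : j ≤ m) => ?_) 4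
    exact le_iSup₂_of_le (f := fun j (_ : j ≤ n) => f j x) j (hj.trans hmn) le_rfl

lemma continuous_truncWave {ν μ : ℝ} {g : ℝ → ℂ} (hgm : Measurable g) (hg : Integrable g) (x : ℝ) :
    Continuous fun p : ℝ × ℝ => truncWave ν μ g x p.1 p.2 := by
  refine continuous_iff_continuousAt.2 fun p₀ => ?_
  refine continuousAt_of_dominated (bound := fun ξ => ‖g ξ‖) ?_ ?_ hg.norm ?_
  · exact Filter.Eventually.of_forall fun p => ((measurable_truncKernel measurable_const
      measurable_const measurable_const measurable_id).mul hgm).aestronglyMeasurable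
  · refine Filter.Eventually.of_forall fun p => Filter.Eventually.of_forall fun ξ => ?_
    rw [norm_mul]
    exact (mul_le_mul_of_nonneg_right (norm_truncKernel_le_one _ _ _ _ _ _)
      (norm_nonneg _)).trans_eq (one_mul _)
  · have hne : ∀ᵐ ξ : ℝ, |ξ| ≠ p₀.2 := by
      have hfin : ({p₀.2, -p₀.2} : Set ℝ).Finite := Set.toFinite _
      filter_upwards [compl_mem_ae_iff.2 (hfin.measure_zero volume)] with ξ hξ h
      apply hξ
      rcases abs_choice ξ with h' | h'
      · left; linarith
      · right; simp only [Set.mem_singleton_iff]; linarith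
    filter_upwards [hne] with ξ hξ
    refine ContinuousAt.mul ?_ continuousAt_const
    by_cases ha : aconst ν μ ≤ |ξ|
    swap
    · simp only [truncKernel, ha, false_and, if_false]; exact continuousAt_const
    rcases lt_or_gt_of_ne hξ with h | h
    · have hc : ContinuousAt (fun p : ℝ × ℝ =>
          ((|ξ| ^ (-(1 / 4) : ℝ) : ℝ) : ℂ) * planeWave ν μ x p.1 ξ) p₀ :=
        (continuous_const.mul ((continuous_planeWave ν μ).comp
          (by fun_prop : Continuous fun p : ℝ × ℝ => (x, p.1, ξ)))).continuousAt
      refine hc.congr ?_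
      filter_upwards [continuous_snd.continuousAt.eventually (lt_mem_nhds h)] with p hp
      simp [truncKernel, ha, hp]
    · refine (continuousAt_const (y := (0 : ℂ))).congr ?_
      filter_upwards [continuous_snd.continuousAt.eventually (gt_mem_nhds h)] with p hp
      simp [truncKernel, not_lt.2 (le_of_lt hp)]

lemma enorm_truncWave_le_maxWave {ν μ : ℝ} {g : ℝ → ℂ} (hgm : Measurable g) (hg : Integrable g)
    (x t k : ℝ) : ‖truncWave ν μ g x t k‖ₑ ≤ maxWave ν μ g x := by
  have hcl : IsClosed {p : ℝ × ℝ | ‖truncWave ν μ g x p.1 p.2‖ₑ ≤ maxWave ν μ g x} :=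
    isClosed_le (continuous_truncWave hgm hg x).enorm continuous_const
  refine (TopologicalSpace.denseRange_denseSeq (ℝ × ℝ)).induction_on
    (p := fun p => ‖truncWave ν μ g x p.1 p.2‖ₑ ≤ maxWave ν μ g x) (t, k) hcl fun j => ?_
  exact le_iSup (fun j : ℕ => ‖truncWave ν μ g x (TopologicalSpace.denseSeq (ℝ × ℝ) j).1
    (TopologicalSpace.denseSeq (ℝ × ℝ) j).2‖ₑ) j

lemma maxWave_ne_top {ν μ : ℝ} {g : ℝ → ℂ} (hg : Integrable g) (x : ℝ) :
    maxWave ν μ g x ≠ ∞ := by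
  refine ((iSup_le fun j => ?_ : maxWave ν μ g x ≤ ENNReal.ofReal (∫ ξ, ‖g ξ‖)).trans_lt
    ENNReal.ofReal_lt_top).ne
  rw [← ofReal_norm]
  refine ENNReal.ofReal_le_ofReal (norm_integral_le_of_norm_le hg.norm
    (Filter.Eventually.of_forall fun ξ => ?_))
  rw [norm_mul]
  exact (mul_le_mul_of_nonneg_right (norm_truncKernel_le_one _ _ _ _ _ _)
    (norm_nonneg _)).trans_eq (one_mul _)

/-- The Fourier transform of the Gaussian `exp (-ε t²)`. -/
def gaussianHat (ε s : ℝ) : ℝ := √(π / ε) * Real.exp (-(1 / (4 * ε)) * s ^ 2)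

lemma gaussianHat_nonneg (ε s : ℝ) : 0 ≤ gaussianHat ε s := by unfold gaussianHat; positivity

lemma measurable_gaussianHat (ε : ℝ) : Measurable (gaussianHat ε) := by
  unfold gaussianHat; fun_prop

lemma integral_gaussian_mul_exp {ε : ℝ} (hε : 0 < ε) (s : ℝ) :
    ∫ t : ℝ, ((Real.exp (-ε * t ^ 2) : ℝ) : ℂ) * Complex.exp (Complex.I * ((t * s : ℝ) : ℂ)) =
      (gaussianHat ε s : ℂ) := by
  have h := fourierIntegral_gaussian (b := (ε : ℂ)) (by simpa using hε) (s : ℂ)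
  have e : ∀ t : ℝ, ((Real.exp (-ε * t ^ 2) : ℝ) : ℂ) *
      Complex.exp (Complex.I * ((t * s : ℝ) : ℂ)) =
      Complex.exp (Complex.I * s * t) * Complex.exp (-ε * t ^ 2) := by
    intro t; push_cast; rw [mul_comm]; congr 2; ring
  simp only [e, h]
  unfold gaussianHat
  rw [Real.sqrt_eq_rpow]
  push_cast
  rw [Complex.ofReal_cpow (by positivity)]
  push_cast
  congr 2
  field_simp

lemma lintegral_gaussianHat {ε : ℝ} (hε : 0 < ε) (c : ℝ) :
    ∫⁻ y, ENNReal.ofReal (gaussianHat ε (c - y)) = ENNReal.ofReal (2 * π) := by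
  have h1 : ∫ y, gaussianHat ε y = 2 * π := by
    unfold gaussianHat
    rw [integral_const_mul, integral_gaussian, ← Real.sqrt_mul (by positivity)]
    rw [show π / ε * (π / (1 / (4 * ε))) = (2 * π) ^ 2 by field_simp; ring]
    exact Real.sqrt_sq (by positivity)
  have h2 : Integrable (gaussianHat ε) :=
    (integrable_exp_neg_mul_sq (b := 1 / (4 * ε)) (by positivity)).const_mul _
  rw [lintegral_sub_left_eq_self (fun y => ENNReal.ofReal (gaussianHat ε y)) c, ← h1,
    ofReal_integral_eq_lintegral_ofReal h2
      (Filter.Eventually.of_forall fun y => gaussianHat_nonneg ε y)]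

lemma two_mul_enorm_mul_enorm_le (u v : ℂ) {d e : ℝ} (hd : 0 < d) (he : 0 < e) :
    2 * (‖u‖ₑ * ‖v‖ₑ) ≤ ‖u‖ₑ ^ 2 / ENNReal.ofReal d * ENNReal.ofReal e +
      ‖v‖ₑ ^ 2 / ENNReal.ofReal e * ENNReal.ofReal d := by
  simp only [← ofReal_norm]
  rw [← ENNReal.ofReal_pow (norm_nonneg _), ← ENNReal.ofReal_pow (norm_nonneg _),
    ← ENNReal.ofReal_div_of_pos hd, ← ENNReal.ofReal_div_of_pos he,
    ← ENNReal.ofReal_mul (norm_nonneg _), ← ENNReal.ofReal_mul (by positivity),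
    ← ENNReal.ofReal_mul (by positivity), ← ENNReal.ofReal_add (by positivity) (by positivity),
    ← ENNReal.ofReal_ofNat, ← ENNReal.ofReal_mul (by norm_num)]
  refine ENNReal.ofReal_le_ofReal ?_
  have : ‖u‖ ^ 2 / d * e + ‖v‖ ^ 2 / e * d - 2 * (‖u‖ * ‖v‖) =
      (‖u‖ * e - ‖v‖ * d) ^ 2 / (d * e) := by field_simp; ring
  have h2 : 0 ≤ (‖u‖ * e - ‖v‖ * d) ^ 2 / (d * e) := by positivity
  linarith

lemma lintegral_gaussian_mul_sq_le {m : Measure ℝ} [SFinite m] {φ : ℝ → ℝ} (hφ : Measurable φ)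
    {h : ℝ → ℂ} (hhm : Measurable h) (hh : Integrable h m) {ε : ℝ} (hε : 0 < ε) :
    ∫⁻ t : ℝ, ENNReal.ofReal (Real.exp (-ε * t ^ 2)) *
        ‖∫ ξ, Complex.exp (Complex.I * ((t * φ ξ : ℝ) : ℂ)) * h ξ ∂m‖ₑ ^ 2 ≤
      ∫⁻ ξ, ∫⁻ η, ‖h ξ‖ₑ * ‖h η‖ₑ * ENNReal.ofReal (gaussianHat ε (φ ξ - φ η)) ∂m ∂m := by
  set H : ℝ → ℂ := fun t => ∫ ξ, Complex.exp (Complex.I * ((t * φ ξ : ℝ) : ℂ)) * h ξ ∂m with hH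
  have hG := integrable_exp_neg_mul_sq hε
  set Φ : ℝ → ℝ × ℝ → ℂ := fun t p => ((Real.exp (-ε * t ^ 2) : ℝ) : ℂ) *
    ((Complex.exp (Complex.I * ((t * φ p.1 : ℝ) : ℂ)) * h p.1) *
      (starRingEnd ℂ) (Complex.exp (Complex.I * ((t * φ p.2 : ℝ) : ℂ)) * h p.2)) with hΦ
  have hexp : ∀ r : ℝ, ‖Complex.exp (Complex.I * (r : ℂ))‖ = 1 := fun r => by
    rw [mul_comm]; exact Complex.norm_exp_ofReal_mul_I r
  have hΦm : Measurable (Function.uncurry Φ) := by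
    have m0 : Measurable fun q : ℝ × ℝ × ℝ => ((Real.exp (-ε * q.1 ^ 2) : ℝ) : ℂ) := by fun_prop
    have aux : Measurable fun p : ℝ × ℝ =>
        Complex.exp (Complex.I * ((p.1 * φ p.2 : ℝ) : ℂ)) * h p.2 := by fun_prop
    have m1 := aux.comp (measurable_fst.prodMk (measurable_fst.comp measurable_snd) :
      Measurable fun q : ℝ × ℝ × ℝ => (q.1, q.2.1))
    have m2 := aux.comp (measurable_fst.prodMk (measurable_snd.comp measurable_snd) :
      Measurable fun q : ℝ × ℝ × ℝ => (q.1, q.2.2))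
    exact m0.mul (m1.mul (Complex.continuous_conj.measurable.comp m2))
  have hΦn : ∀ t p, ‖Φ t p‖ = Real.exp (-ε * t ^ 2) * (‖h p.1‖ * ‖h p.2‖) := by
    intro t p
    simp only [hΦ, norm_mul, RCLike.norm_conj, hexp, one_mul, Complex.norm_real,
      Real.norm_eq_abs, Real.abs_exp]
  have hΦi : Integrable (Function.uncurry Φ) (volume.prod (m.prod m)) := by
    refine (hG.mul_prod (hh.norm.mul_prod hh.norm)).mono' hΦm.aestronglyMeasurable
      (Filter.Eventually.of_forall fun q => ?_)
    exact (hΦn q.1 q.2).le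
  have hHH : ∀ t, ((Real.exp (-ε * t ^ 2) * ‖H t‖ ^ 2 : ℝ) : ℂ) = ∫ p, Φ t p ∂(m.prod m) := by
    intro t
    rw [Complex.ofReal_mul, Complex.ofReal_pow, ← Complex.mul_conj', hH]
    simp only [hΦ]
    rw [← integral_conj, integral_const_mul]
    congr 1
    exact (integral_prod_mul _ _).symm
  have hHint : Integrable fun t => Real.exp (-ε * t ^ 2) * ‖H t‖ ^ 2 := by
    have h1 := hΦi.integral_prod_left
    have h2 : Integrable fun t => ((Real.exp (-ε * t ^ 2) * ‖H t‖ ^ 2 : ℝ) : ℂ) := by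
      simp only [hHH]; exact h1
    exact h2.re
  have e0 : ∫⁻ t : ℝ, ENNReal.ofReal (Real.exp (-ε * t ^ 2)) * ‖H t‖ₑ ^ 2 =
      ‖∫ t, ∫ p, Φ t p ∂(m.prod m)‖ₑ := by
    simp only [← hHH]
    rw [integral_complex_ofReal, ← ofReal_norm, Complex.norm_real, Real.norm_eq_abs,
      abs_of_nonneg (integral_nonneg fun t => by positivity),
      ofReal_integral_eq_lintegral_ofReal hHint
        (Filter.Eventually.of_forall fun t => by positivity)]
    refine lintegral_congr fun t => ?_
    rw [ENNReal.ofReal_mul (Real.exp_nonneg _), ENNReal.ofReal_pow (norm_nonneg _), ofReal_norm]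
  rw [e0, integral_integral_swap hΦi]
  refine (enorm_integral_le_lintegral_enorm _).trans ((lintegral_prod_le _).trans ?_)
  refine lintegral_mono fun ξ => lintegral_mono fun η => le_of_eq ?_
  have : ∀ t, Φ t (ξ, η) = (h ξ * (starRingEnd ℂ) (h η)) * (((Real.exp (-ε * t ^ 2) : ℝ) : ℂ) *
      Complex.exp (Complex.I * ((t * (φ ξ - φ η) : ℝ) : ℂ))) := by
    intro t
    have e : Complex.exp (Complex.I * ((t * (φ ξ - φ η) : ℝ) : ℂ)) =
        Complex.exp (Complex.I * ((t * φ ξ : ℝ) : ℂ)) *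
          (starRingEnd ℂ) (Complex.exp (Complex.I * ((t * φ η : ℝ) : ℂ))) := by
      rw [← Complex.exp_conj, ← Complex.exp_add, map_mul, Complex.conj_I, Complex.conj_ofReal]
      congr 1; push_cast; ring
    simp only [hΦ, map_mul, e]; ring
  simp only [this]
  rw [integral_const_mul, integral_gaussian_mul_exp hε, enorm_mul, enorm_mul, RCLike.enorm_conj,
    ← ofReal_norm (gaussianHat ε _ : ℂ), Complex.norm_real, Real.norm_eq_abs,
    abs_of_nonneg (gaussianHat_nonneg _ _)]

/-- The Plancherel inequality for oscillatory integrals damped by a Gaussian in time. -/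
lemma lintegral_gaussian_mul_oscillatory_sq_le {S : Set ℝ} (hS : MeasurableSet S) {φ φ' : ℝ → ℝ}
    (hφ : Measurable φ) (hφ' : Measurable φ') (hder : ∀ ξ ∈ S, HasDerivAt φ (φ' ξ) ξ)
    (hinj : Set.InjOn φ S) (hne : ∀ ξ ∈ S, φ' ξ ≠ 0)
    {h : ℝ → ℂ} (hhm : Measurable h) (hh : IntegrableOn h S) {ε : ℝ} (hε : 0 < ε) :
    ∫⁻ t : ℝ, ENNReal.ofReal (Real.exp (-ε * t ^ 2)) *
        ‖∫ ξ in S, Complex.exp (Complex.I * ((t * φ ξ : ℝ) : ℂ)) * h ξ‖ₑ ^ 2 ≤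
      ENNReal.ofReal (2 * π) * ∫⁻ ξ in S, ‖h ξ‖ₑ ^ 2 / ENNReal.ofReal |φ' ξ| := by
  set Q := ∫⁻ ξ in S, ‖h ξ‖ₑ ^ 2 / ENNReal.ofReal |φ' ξ| with hQ
  refine (lintegral_gaussian_mul_sq_le hφ hhm hh hε).trans ?_
  set Γ : ℝ → ℝ → ℝ≥0∞ := fun ξ η => ENNReal.ofReal (gaussianHat ε (φ ξ - φ η)) with hΓ
  have hΓm : Measurable (Function.uncurry Γ) := ((measurable_gaussianHat ε).comp
    ((hφ.comp measurable_fst).sub (hφ.comp measurable_snd))).ennreal_ofReal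
  have hΓs : ∀ ξ η, Γ ξ η = Γ η ξ := fun ξ η => by
    simp only [hΓ, gaussianHat]
    rw [show (φ ξ - φ η) ^ 2 = (φ η - φ ξ) ^ 2 by ring]
  have hΓ1 : ∀ ξ, ∫⁻ η in S, ENNReal.ofReal |φ' η| * Γ ξ η ≤ ENNReal.ofReal (2 * π) := by
    intro ξ
    have := lintegral_image_eq_lintegral_abs_deriv_mul hS
      (fun η hη => (hder η hη).hasDerivWithinAt) hinj
      (fun y => ENNReal.ofReal (gaussianHat ε (φ ξ - y)))
    rw [← lintegral_gaussianHat hε (φ ξ)]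
    exact this.symm.trans_le (setLIntegral_le_lintegral _ _)
  set A : ℝ → ℝ → ℝ≥0∞ := fun ξ η =>
    ‖h ξ‖ₑ ^ 2 / ENNReal.ofReal |φ' ξ| * (ENNReal.ofReal |φ' η| * Γ ξ η) with hA
  have hAm : Measurable (Function.uncurry A) := by
    have m1 : Measurable fun ξ => ‖h ξ‖ₑ ^ 2 / ENNReal.ofReal |φ' ξ| :=
      (hhm.enorm.pow_const 2).div hφ'.norm.ennreal_ofReal
    exact (m1.comp measurable_fst).mul
      ((hφ'.norm.ennreal_ofReal.comp measurable_snd).mul hΓm)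
  have hA1 : ∫⁻ ξ in S, ∫⁻ η in S, A ξ η ≤ ENNReal.ofReal (2 * π) * Q := by
    rw [hQ, ← lintegral_const_mul' _ _ ENNReal.ofReal_ne_top]
    refine lintegral_mono fun ξ => ?_
    have m : Measurable fun η => ENNReal.ofReal |φ' η| * Γ ξ η :=
      hφ'.norm.ennreal_ofReal.mul (hΓm.of_uncurry_left (x := ξ))
    change ∫⁻ η in S, ‖h ξ‖ₑ ^ 2 / ENNReal.ofReal |φ' ξ| * (ENNReal.ofReal |φ' η| * Γ ξ η) ≤ _
    rw [lintegral_const_mul _ m, mul_comm]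
    gcongr
    exact hΓ1 ξ
  have hA2 : ∫⁻ ξ in S, ∫⁻ η in S, A η ξ ≤ ENNReal.ofReal (2 * π) * Q := by
    rw [lintegral_lintegral_swap]
    · exact hA1
    · exact (hAm.comp measurable_swap).aemeasurable
  have key : 2 * ∫⁻ ξ in S, ∫⁻ η in S, ‖h ξ‖ₑ * ‖h η‖ₑ * Γ ξ η ≤
      2 * (ENNReal.ofReal (2 * π) * Q) := by
    calc _ = ∫⁻ ξ in S, ∫⁻ η in S, 2 * (‖h ξ‖ₑ * ‖h η‖ₑ) * Γ ξ η := by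
          rw [← lintegral_const_mul' _ _ ENNReal.ofNat_ne_top]
          refine lintegral_congr fun ξ => ?_
          rw [← lintegral_const_mul' _ _ ENNReal.ofNat_ne_top]
          simp only [mul_assoc]
      _ ≤ ∫⁻ ξ in S, ∫⁻ η in S, (A ξ η + A η ξ) := by
          refine setLIntegral_mono' hS fun ξ hξ => setLIntegral_mono' hS fun η hη => ?_
          have := two_mul_enorm_mul_enorm_le (h ξ) (h η) (abs_pos.2 (hne ξ hξ))
            (abs_pos.2 (hne η hη))
          calc _ ≤ _ := mul_le_mul_left this (Γ ξ η)
            _ = _ := by simp only [hA, hΓs η ξ]; ring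
      _ = (∫⁻ ξ in S, ∫⁻ η in S, A ξ η) + ∫⁻ ξ in S, ∫⁻ η in S, A η ξ := by
          have m : Measurable fun ξ => ∫⁻ η in S, A ξ η := hAm.lintegral_prod_right'
          rw [← lintegral_add_left m]
          exact lintegral_congr fun ξ => lintegral_add_left (hAm.of_uncurry_left (x := ξ)) _
      _ ≤ _ := by rw [two_mul]; exact add_le_add hA1 hA2
  exact (ENNReal.mul_le_mul_iff_right (by norm_num) ENNReal.ofNat_ne_top).1 key

/-- The Plancherel inequality in time for oscillatory integrals with an injective phase. -/
lemma lintegral_oscillatory_sq_le {S : Set ℝ} (hS : MeasurableSet S) {φ φ' : ℝ → ℝ}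
    (hφ : Measurable φ) (hφ' : Measurable φ') (hder : ∀ ξ ∈ S, HasDerivAt φ (φ' ξ) ξ)
    (hinj : Set.InjOn φ S) (hne : ∀ ξ ∈ S, φ' ξ ≠ 0)
    {h : ℝ → ℂ} (hhm : Measurable h) (hh : IntegrableOn h S) :
    ∫⁻ t : ℝ, ‖∫ ξ in S, Complex.exp (Complex.I * ((t * φ ξ : ℝ) : ℂ)) * h ξ‖ₑ ^ 2 ≤
      ENNReal.ofReal (2 * π) * ∫⁻ ξ in S, ‖h ξ‖ₑ ^ 2 / ENNReal.ofReal |φ' ξ| := by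
  set F : ℝ → ℝ≥0∞ := fun t =>
    ‖∫ ξ in S, Complex.exp (Complex.I * ((t * φ ξ : ℝ) : ℂ)) * h ξ‖ₑ ^ 2 with hF
  have hFm : Measurable F := by
    have : StronglyMeasurable (Function.uncurry fun t ξ : ℝ =>
        Complex.exp (Complex.I * ((t * φ ξ : ℝ) : ℂ)) * h ξ) := by
      apply Measurable.stronglyMeasurable
      simp only [Function.uncurry_def]
      fun_prop
    exact (this.integral_prod_right (ν := volume.restrict S)).measurable.enorm.pow_const 2
  have hlim : ∀ t : ℝ, Filter.Tendsto (fun n : ℕ =>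
      ENNReal.ofReal (Real.exp (-(1 / ((n : ℝ) + 1)) * t ^ 2)) * F t) Filter.atTop
      (nhds (F t)) := by
    intro t
    have h1 : Filter.Tendsto (fun n : ℕ => Real.exp (-(1 / ((n : ℝ) + 1)) * t ^ 2)) Filter.atTop
        (nhds 1) := by
      have := (tendsto_one_div_add_atTop_nhds_zero_nat (𝕜 := ℝ)).neg.mul_const (t ^ 2)
      simpa [Function.comp_def] using (Real.continuous_exp.tendsto _).comp this
    have h2 := ENNReal.Tendsto.mul_const (b := F t)
      ((ENNReal.continuous_ofReal.tendsto _).comp h1) (Or.inl (by simp))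
    simpa [Function.comp_def] using h2
  calc ∫⁻ t, F t = ∫⁻ t, Filter.liminf (fun n : ℕ =>
        ENNReal.ofReal (Real.exp (-(1 / ((n : ℝ) + 1)) * t ^ 2)) * F t) Filter.atTop :=
      lintegral_congr fun t => (hlim t).liminf_eq.symm
    _ ≤ Filter.liminf (fun n : ℕ => ∫⁻ t,
        ENNReal.ofReal (Real.exp (-(1 / ((n : ℝ) + 1)) * t ^ 2)) * F t) Filter.atTop :=
      lintegral_liminf_le fun n => by fun_prop
    _ ≤ _ := by
      refine Filter.liminf_le_of_le (by isBoundedDefault) fun b hb => ?_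
      obtain ⟨n, hn⟩ := hb.exists
      exact hn.trans (lintegral_gaussian_mul_oscillatory_sq_le hS hφ hφ' hder hinj hne hhm hh
        (by positivity))

lemma abs_nu_le_mul_aconst {ν μ : ℝ} (hμ : μ ≠ 0) : |ν| ≤ 3 / 4 * |μ| * aconst ν μ := by
  have h := four_thirds_mul_abs_le_aconst ν μ
  rw [abs_div] at h
  have hm : 0 < |μ| := abs_pos.2 hμ
  have : |ν| = |μ| * (|ν| / |μ|) := by field_simp
  rw [this]
  nlinarith

lemma abs_nu_mul_abs_le {ν μ ξ : ℝ} (hμ : μ ≠ 0) (hξ : aconst ν μ ≤ |ξ|) :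
    |ν| * |ξ| ≤ 3 / 4 * |μ| * ξ ^ 2 := by
  have h := abs_nu_le_mul_aconst (ν := ν) hμ
  have hm : 0 < |μ| := abs_pos.2 hμ
  rw [← sq_abs ξ]
  calc |ν| * |ξ| ≤ (3 / 4 * |μ| * |ξ|) * |ξ| := by
        gcongr; exact h.trans (by gcongr)
    _ = _ := by ring

lemma le_abs_dphase {ν μ ξ : ℝ} (hμ : μ ≠ 0) (hξ : aconst ν μ ≤ |ξ|) :
    3 / 2 * |μ| * ξ ^ 2 ≤ |dphase ν μ ξ| := by
  have h := abs_nu_mul_abs_le hμ hξ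
  have h1 : |3 * μ * ξ ^ 2| = 3 * |μ| * ξ ^ 2 := by
    rw [abs_mul, abs_mul, abs_of_nonneg (sq_nonneg ξ)]; norm_num
  have h2 : |(2 * ν * |ξ|)| = 2 * (|ν| * |ξ|) := by
    rw [abs_mul, abs_mul, abs_abs]; norm_num; ring
  have h3 := abs_sub_abs_le_abs_sub (3 * μ * ξ ^ 2) (2 * ν * |ξ|)
  rw [h1, h2] at h3
  have h4 : dphase ν μ ξ = 3 * μ * ξ ^ 2 - 2 * ν * |ξ| := by unfold dphase; ring
  rw [h4]; linarith

lemma hasDerivAt_phase (ν μ : ℝ) {ξ : ℝ} (hξ : ξ ≠ 0) :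
    HasDerivAt (phase ν μ) (dphase ν μ ξ) ξ := by
  rcases lt_or_gt_of_ne hξ with h | h
  · have h1 : HasDerivAt (fun y : ℝ => ν * y ^ 2 + μ * y ^ 3) (dphase ν μ ξ) ξ := by
      refine (((hasDerivAt_pow 2 ξ).const_mul ν).add ((hasDerivAt_pow 3 ξ).const_mul μ)).congr_deriv
        ?_
      simp only [dphase, abs_of_neg h]; push_cast; ring
    refine h1.congr_of_eventuallyEq ?_
    filter_upwards [gt_mem_nhds h] with y hy
    simp only [phase, abs_of_neg hy]; ring
  · have h1 : HasDerivAt (fun y : ℝ => -ν * y ^ 2 + μ * y ^ 3) (dphase ν μ ξ) ξ := by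
      refine (((hasDerivAt_pow 2 ξ).const_mul (-ν)).add
        ((hasDerivAt_pow 3 ξ).const_mul μ)).congr_deriv ?_
      simp only [dphase, abs_of_pos h]; push_cast; ring
    refine h1.congr_of_eventuallyEq ?_
    filter_upwards [lt_mem_nhds h] with y hy
    simp only [phase, abs_of_pos hy]; ring

lemma mul_phase_mul_pos {ν μ ξ : ℝ} (hμ : μ ≠ 0) (hξ : aconst ν μ ≤ |ξ|) :
    0 < μ * phase ν μ ξ * ξ := by
  have h := abs_nu_mul_abs_le hμ hξ
  have hx : 0 < |ξ| := by linarith [two_le_aconst ν μ]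
  have hx2 : 0 < ξ ^ 2 := by rw [← sq_abs]; positivity
  have hm : 0 < |μ| := abs_pos.2 hμ
  have e : μ * phase ν μ ξ * ξ = ξ ^ 2 * (|μ| ^ 2 * ξ ^ 2 - μ * ν * |ξ|) := by
    rw [sq_abs]; unfold phase; ring
  rw [e]
  refine mul_pos hx2 ?_
  have h1 : μ * ν * |ξ| ≤ |μ| * (|ν| * |ξ|) := by
    rw [← mul_assoc, ← abs_mul]; gcongr; exact le_abs_self _
  nlinarith [mul_pos (mul_pos hm hm) hx2]

lemma injOn_phase {ν μ : ℝ} (hμ : μ ≠ 0) : Set.InjOn (phase ν μ) {ξ | aconst ν μ ≤ |ξ|} := by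
  intro ξ hξ η hη heq
  simp only [Set.mem_ofPred_eq] at hξ hη
  have hm : 0 < |μ| := abs_pos.2 hμ
  have p1 := mul_phase_mul_pos hμ hξ
  have p2 := mul_phase_mul_pos hμ hη
  have hsame : 0 < ξ * η := by
    rw [← heq] at p2
    have h1 := mul_pos p1 p2
    have h2 : μ * phase ν μ ξ * ξ * (μ * phase ν μ ξ * η) = (μ * phase ν μ ξ) ^ 2 * (ξ * η) := by
      ring
    rw [h2] at h1
    exact pos_of_mul_pos_right h1 (sq_nonneg _)
  obtain ⟨σ, hσ, e1, e2⟩ : ∃ σ : ℝ, |σ| = 1 ∧ |ξ| = σ * ξ ∧ |η| = σ * η := by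
    rcases lt_trichotomy ξ 0 with h | h | h
    · have h' : η < 0 := by nlinarith
      exact ⟨-1, by norm_num, by rw [abs_of_neg h]; ring, by rw [abs_of_neg h']; ring⟩
    · simp [h] at hsame
    · have h' : 0 < η := by nlinarith
      exact ⟨1, by norm_num, by rw [abs_of_pos h]; ring, by rw [abs_of_pos h']; ring⟩
  by_contra hne
  have hfac : (ξ - η) * (μ * (ξ ^ 2 + ξ * η + η ^ 2) - ν * σ * (ξ + η)) = 0 := by
    unfold phase at heq
    rw [e1, e2] at heq
    linear_combination heq
  have h0 := (mul_eq_zero.1 hfac).resolve_left (sub_ne_zero.2 hne)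
  have h1 : |μ * (ξ ^ 2 + ξ * η + η ^ 2)| = |ν * σ * (ξ + η)| := by rw [sub_eq_zero.1 h0]
  rw [abs_mul, abs_mul, abs_mul, hσ,
    abs_of_nonneg (by positivity : 0 ≤ ξ ^ 2 + ξ * η + η ^ 2)] at h1
  have h2 : |ν| * |ξ + η| ≤ |ν| * |ξ| + |ν| * |η| := by
    rw [← mul_add]; gcongr; exact abs_add_le _ _
  have h3 := abs_nu_mul_abs_le hμ hξ
  have h4 := abs_nu_mul_abs_le hμ hη
  nlinarith [mul_pos hm hsame, mul_nonneg hm.le (sq_nonneg ξ), mul_nonneg hm.le (sq_nonneg η)]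

/-- The local smoothing estimate with frequency localisation. -/
lemma lintegral_smoothing_le {ν μ : ℝ} (hμ : μ ≠ 0) (α : ℝ) {S : Set ℝ} (hS : MeasurableSet S)
    (hSa : ∀ ξ ∈ S, aconst ν μ ≤ |ξ|) {g : ℝ → ℂ} (hgm : Measurable g)
    (hg : IntegrableOn (fun ξ => ((|ξ| ^ α : ℝ) : ℂ) * g ξ) S) (x : ℝ) :
    ∫⁻ t, ‖∫ ξ in S, ((|ξ| ^ α : ℝ) : ℂ) * planeWave ν μ x t ξ * g ξ‖ₑ ^ 2 ≤
      ENNReal.ofReal (4 * π / (3 * |μ|)) *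
        ∫⁻ ξ in S, ENNReal.ofReal (|ξ| ^ (2 * α - 2)) * ‖g ξ‖ₑ ^ 2 := by
  have hm : 0 < |μ| := abs_pos.2 hμ
  set h : ℝ → ℂ := fun ξ =>
    Complex.exp (Complex.I * ((ξ * x : ℝ) : ℂ)) * (((|ξ| ^ α : ℝ) : ℂ) * g ξ) with hh
  have hgm' : Measurable fun ξ => ((|ξ| ^ α : ℝ) : ℂ) * g ξ :=
    (Complex.measurable_ofReal.comp (measurable_norm.pow_const α)).mul hgm
  have hhm : Measurable h := by
    have : Measurable fun ξ : ℝ => Complex.exp (Complex.I * ((ξ * x : ℝ) : ℂ)) := by fun_prop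
    exact this.mul hgm'
  have hexp : ∀ r : ℝ, ‖Complex.exp (Complex.I * (r : ℂ))‖ = 1 := fun r => by
    rw [mul_comm]; exact Complex.norm_exp_ofReal_mul_I r
  have hn : ∀ ξ, ‖h ξ‖ = |ξ| ^ α * ‖g ξ‖ := fun ξ => by
    simp only [hh, norm_mul, hexp, one_mul, Complex.norm_real, Real.norm_eq_abs]
    rw [abs_of_nonneg (by positivity)]
  have hhi : IntegrableOn h S := by
    refine Integrable.mono hg hhm.aestronglyMeasurable (Filter.Eventually.of_forall fun ξ => ?_)
    rw [hn, norm_mul, Complex.norm_real, Real.norm_eq_abs,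
      abs_of_nonneg (by positivity : 0 ≤ |ξ| ^ α)]
  have hpos : ∀ ξ ∈ S, 0 < |ξ| := fun ξ hξ => by linarith [hSa ξ hξ, two_le_aconst ν μ]
  have hdp : ∀ ξ ∈ S, 0 < 3 / 2 * |μ| * ξ ^ 2 := fun ξ hξ => by
    rw [← sq_abs]; have := hpos ξ hξ; positivity
  have hdm : Measurable (dphase ν μ) := by unfold dphase; fun_prop
  have main := lintegral_oscillatory_sq_le hS (continuous_phase ν μ).measurable hdm
    (fun ξ hξ => hasDerivAt_phase ν μ (abs_pos.1 (hpos ξ hξ)))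
    ((injOn_phase hμ).mono hSa)
    (fun ξ hξ => abs_pos.1 ((hdp ξ hξ).trans_le (le_abs_dphase hμ (hSa ξ hξ)))) hhm hhi
  have e1 : ∀ t, (∫ ξ in S, Complex.exp (Complex.I * ((t * phase ν μ ξ : ℝ) : ℂ)) * h ξ) =
      ∫ ξ in S, ((|ξ| ^ α : ℝ) : ℂ) * planeWave ν μ x t ξ * g ξ := fun t => by
    refine integral_congr_ae (Filter.Eventually.of_forall fun ξ => ?_)
    have : planeWave ν μ x t ξ = Complex.exp (Complex.I * ((t * phase ν μ ξ : ℝ) : ℂ)) *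
        Complex.exp (Complex.I * ((ξ * x : ℝ) : ℂ)) := by
      rw [← Complex.exp_add, planeWave]; congr 1; push_cast; ring
    simp only [hh, this]; ring
  simp only [e1] at main
  refine main.trans ?_
  rw [← lintegral_const_mul' _ _ ENNReal.ofReal_ne_top,
    ← lintegral_const_mul' _ _ ENNReal.ofReal_ne_top]
  refine setLIntegral_mono' hS fun ξ hξ => ?_
  have h0 := hpos ξ hξ
  have h1 := hdp ξ hξ
  rw [← ofReal_norm, hn, ← ofReal_norm, ← ENNReal.ofReal_pow (by positivity),
    ← ENNReal.ofReal_pow (norm_nonneg _),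
    ← ENNReal.ofReal_div_of_pos (h1.trans_le (le_abs_dphase hμ (hSa ξ hξ))),
    ← ENNReal.ofReal_mul (by positivity), ← ENNReal.ofReal_mul (by positivity),
    ← ENNReal.ofReal_mul (by positivity)]
  refine ENNReal.ofReal_le_ofReal ?_
  have h2 : (|ξ| ^ α) ^ 2 = |ξ| ^ (2 * α - 2) * ξ ^ 2 := by
    rw [← sq_abs ξ, ← Real.rpow_natCast, ← Real.rpow_natCast, ← Real.rpow_mul h0.le,
      ← Real.rpow_add h0]
    congr 1; push_cast; ring
  have hx0 : ξ ≠ 0 := abs_pos.1 h0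
  calc 2 * π * ((|ξ| ^ α * ‖g ξ‖) ^ 2 / |dphase ν μ ξ|)
      ≤ 2 * π * ((|ξ| ^ α * ‖g ξ‖) ^ 2 / (3 / 2 * |μ| * ξ ^ 2)) := by
        gcongr; exact le_abs_dphase hμ (hSa ξ hξ)
    _ = _ := by rw [mul_pow, h2]; field_simp; ring

/-- Low frequencies are controlled by the frequency truncations of the maximal function. -/
lemma norm_integral_rpow_mul_truncKernel_le {ν μ β : ℝ} (hβ : 0 < β) {K : ℝ} (hK : 0 ≤ K)
    {g : ℝ → ℂ} (hgm : Measurable g) (hg : Integrable g) {x t M : ℝ}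
    (hM : ∀ s, ‖truncWave ν μ g x t s‖ ≤ M) :
    ‖∫ ξ, ((|ξ| ^ β : ℝ) : ℂ) * (truncKernel ν μ x t K ξ * g ξ)‖ ≤ 2 * (K ^ β * M) := by
  set w : ℝ → ℝ := fun s => β * s ^ (β - 1) with hw
  have hwi : ∀ b : ℝ, IntervalIntegrable w volume b K := fun b =>
    (intervalIntegral.intervalIntegrable_rpow' (by linarith)).const_mul β
  have hwint : ∀ b, 0 ≤ b → ∫ s in b..K, w s = K ^ β - b ^ β := fun b hb => by
    rw [intervalIntegral.integral_const_mul, integral_rpow (Or.inl (by linarith))]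
    rw [sub_add_cancel]; field_simp
  have hwI : IntegrableOn w (Set.Ioc 0 K) :=
    (intervalIntegrable_iff_integrableOn_Ioc_of_le hK).1 (hwi 0)
  have hwm : Measurable w := by
    simp only [hw]; exact (measurable_id.pow_const _).const_mul β
  have hKm : ∀ s, Measurable fun ξ => truncKernel ν μ x t s ξ * g ξ := fun s =>
    (measurable_truncKernel measurable_const measurable_const measurable_const measurable_id).mul
      hgm
  have hKi : ∀ s, Integrable fun ξ => truncKernel ν μ x t s ξ * g ξ := fun s => by
    refine hg.mono (hKm s).aestronglyMeasurable (Filter.Eventually.of_forall fun ξ => ?_)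
    rw [norm_mul]
    exact (mul_le_mul_of_nonneg_right (norm_truncKernel_le_one _ _ _ _ _ _)
      (norm_nonneg _)).trans_eq (one_mul _)
  have pt : ∀ ξ, ((|ξ| ^ β : ℝ) : ℂ) * (truncKernel ν μ x t K ξ * g ξ) =
      ((K ^ β : ℝ) : ℂ) * (truncKernel ν μ x t K ξ * g ξ) -
        ∫ s in Set.Ioc 0 K, (w s : ℂ) * (truncKernel ν μ x t s ξ * g ξ) := by
    intro ξ
    by_cases h : aconst ν μ ≤ |ξ| ∧ |ξ| < K
    · have e : ∀ s, (w s : ℂ) * (truncKernel ν μ x t s ξ * g ξ) =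
          (Set.Ioi |ξ|).indicator (fun s => (w s : ℂ) * (truncKernel ν μ x t K ξ * g ξ)) s := by
        intro s
        rw [Set.indicator_apply]
        simp only [truncKernel, h.1, h.2, true_and, Set.mem_Ioi, and_self, if_true]
        split_ifs <;> simp
      simp only [e]
      rw [setIntegral_indicator measurableSet_Ioi, Set.Ioc_inter_Ioi, max_eq_right (abs_nonneg ξ),
        integral_mul_const, integral_complex_ofReal, ← intervalIntegral.integral_of_le h.2.le,
        hwint _ (abs_nonneg ξ)]
      push_cast; ring
    · have h0 : ∀ s, s ≤ K → truncKernel ν μ x t s ξ = 0 := fun s hs => by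
        rw [truncKernel, if_neg]; exact fun h' => h ⟨h'.1, h'.2.trans_le hs⟩
      rw [h0 K le_rfl, setIntegral_eq_zero_of_forall_eq_zero]
      · simp
      · intro s hs; rw [h0 s hs.2]; simp
  set Ψ : ℝ → ℝ → ℂ := fun ξ s => (w s : ℂ) * (truncKernel ν μ x t s ξ * g ξ) with hΨ
  have hΨm : Measurable (Function.uncurry Ψ) :=
    (Complex.measurable_ofReal.comp (hwm.comp measurable_snd)).mul
      ((measurable_truncKernel measurable_const measurable_const measurable_snd
        measurable_fst).mul (hgm.comp measurable_fst))
  have hΨi : Integrable (Function.uncurry Ψ) (volume.prod (volume.restrict (Set.Ioc 0 K))) := by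
    refine (hg.norm.mul_prod hwI.norm).mono' hΨm.aestronglyMeasurable
      (Filter.Eventually.of_forall fun q => ?_)
    simp only [Function.uncurry, hΨ, norm_mul, Complex.norm_real]
    have := norm_truncKernel_le_one ν μ x t q.2 q.1
    calc _ ≤ ‖w q.2‖ * (1 * ‖g q.1‖) := by gcongr
      _ = _ := by ring
  have hM0 : 0 ≤ M := (norm_nonneg _).trans (hM 0)
  have hΨi' : Integrable fun ξ => ∫ s in Set.Ioc 0 K, Ψ ξ s := hΨi.integral_prod_left
  rw [integral_congr_ae (Filter.Eventually.of_forall pt), integral_sub ((hKi K).const_mul _) hΨi',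
    integral_const_mul, integral_integral_swap hΨi]
  have b1 : ‖((K ^ β : ℝ) : ℂ) * ∫ ξ, truncKernel ν μ x t K ξ * g ξ‖ ≤ K ^ β * M := by
    rw [norm_mul, Complex.norm_real, Real.norm_eq_abs, abs_of_nonneg (by positivity)]
    gcongr; exact hM K
  have b2 : ‖∫ s in Set.Ioc 0 K, ∫ ξ, Ψ ξ s‖ ≤ K ^ β * M := by
    have hb : ∫ s in Set.Ioc 0 K, w s * M = K ^ β * M := by
      rw [integral_mul_const, ← intervalIntegral.integral_of_le hK, hwint 0 le_rfl,
        Real.zero_rpow hβ.ne', sub_zero]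
    rw [← hb]
    refine norm_integral_le_of_norm_le (hwI.mul_const M)
      ((ae_restrict_iff' measurableSet_Ioc).2 (Filter.Eventually.of_forall fun s hs => ?_))
    simp only [hΨ]
    have hs0 : 0 < s := hs.1
    have hw0 : 0 ≤ w s := by simp only [hw]; positivity
    rw [integral_const_mul, norm_mul, Complex.norm_real, Real.norm_eq_abs, abs_of_nonneg hw0]
    gcongr; exact hM s
  linarith [norm_sub_le (((K ^ β : ℝ) : ℂ) * ∫ ξ, truncKernel ν μ x t K ξ * g ξ)
    (∫ s in Set.Ioc 0 K, ∫ ξ, Ψ ξ s)]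

/-- `D_x^α S(t) P^a` applied to the data with Fourier transform `g`. -/
def derivWave (ν μ α : ℝ) (g : ℝ → ℂ) (x t : ℝ) : ℂ :=
  ∫ ξ in {ξ | aconst ν μ ≤ |ξ|}, ((|ξ| ^ α : ℝ) : ℂ) * planeWave ν μ x t ξ * g ξ

lemma measurableSet_aconst_le (ν μ : ℝ) : MeasurableSet {ξ : ℝ | aconst ν μ ≤ |ξ|} :=
  measurableSet_le measurable_const measurable_norm

lemma measurable_rpow_mul_planeWave_mul {ν μ α : ℝ} {g : ℝ → ℂ} (hgm : Measurable g) (x : ℝ) :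
    Measurable (Function.uncurry fun t ξ => ((|ξ| ^ α : ℝ) : ℂ) * planeWave ν μ x t ξ * g ξ) := by
  have h1 : Measurable fun ξ : ℝ => ((|ξ| ^ α : ℝ) : ℂ) :=
    Complex.measurable_ofReal.comp (measurable_norm.pow_const α)
  have h2 : Measurable fun p : ℝ × ℝ => planeWave ν μ x p.1 p.2 :=
    (continuous_planeWave ν μ).measurable.comp
      (measurable_const.prodMk (measurable_fst.prodMk measurable_snd))
  exact ((h1.comp measurable_snd).mul h2).mul (hgm.comp measurable_snd)

lemma measurable_setIntegral_wave {ν μ α : ℝ} {g : ℝ → ℂ} (hgm : Measurable g) (x : ℝ)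
    (S : Set ℝ) :
    Measurable fun t => ∫ ξ in S, ((|ξ| ^ α : ℝ) : ℂ) * planeWave ν μ x t ξ * g ξ :=
  (measurable_rpow_mul_planeWave_mul hgm x).stronglyMeasurable.integral_prod_right.measurable

lemma integrableOn_rpow_mul_planeWave_mul {ν μ α : ℝ} {g : ℝ → ℂ} (hgm : Measurable g) {S : Set ℝ}
    (hg : IntegrableOn (fun ξ => ((|ξ| ^ α : ℝ) : ℂ) * g ξ) S) (x t : ℝ) :
    IntegrableOn (fun ξ => ((|ξ| ^ α : ℝ) : ℂ) * planeWave ν μ x t ξ * g ξ) S := by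
  refine Integrable.mono hg
    ((measurable_rpow_mul_planeWave_mul hgm x).of_uncurry_left (x := t)).aestronglyMeasurable
    (Filter.Eventually.of_forall fun ξ => ?_)
  rw [norm_mul, norm_mul, norm_planeWave, mul_one, norm_mul]

/-- Decomposition into low and high frequencies. -/
lemma derivWave_eq_low_add_high {ν μ α : ℝ} {g : ℝ → ℂ} (hgm : Measurable g)
    (hg : IntegrableOn (fun ξ => ((|ξ| ^ α : ℝ) : ℂ) * g ξ) {ξ | aconst ν μ ≤ |ξ|}) (K x t : ℝ) :
    derivWave ν μ α g x t =
      (∫ ξ, ((|ξ| ^ (α + 1 / 4) : ℝ) : ℂ) * (truncKernel ν μ x t K ξ * g ξ)) +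
        ∫ ξ in {ξ | aconst ν μ ≤ |ξ| ∧ K ≤ |ξ|},
          ((|ξ| ^ α : ℝ) : ℂ) * planeWave ν μ x t ξ * g ξ := by
  have hE : {ξ : ℝ | aconst ν μ ≤ |ξ|} =
      freqBand (aconst ν μ) K ∪ {ξ | aconst ν μ ≤ |ξ| ∧ K ≤ |ξ|} := by
    ext ξ
    simp only [freqBand, Set.mem_union, Set.mem_ofPred_eq]
    have := lt_or_ge |ξ| K
    tauto
  have hi := integrableOn_rpow_mul_planeWave_mul (ν := ν) (μ := μ) hgm hg x t
  have hm2 : MeasurableSet {ξ : ℝ | aconst ν μ ≤ |ξ| ∧ K ≤ |ξ|} :=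
    (measurableSet_aconst_le ν μ).inter (measurableSet_le measurable_const measurable_norm)
  have hdisj : Disjoint (freqBand (aconst ν μ) K) {ξ | aconst ν μ ≤ |ξ| ∧ K ≤ |ξ|} :=
    Set.disjoint_left.2 fun ξ h1 h2 => absurd h1.2 (not_lt.2 h2.2)
  rw [derivWave, hE, setIntegral_union hdisj hm2 (hi.mono_set (hE ▸ Set.subset_union_left))
    (hi.mono_set (hE ▸ Set.subset_union_right))]
  congr 1
  rw [← integral_indicator (measurableSet_freqBand _ _)]
  refine integral_congr_ae (Filter.Eventually.of_forall fun ξ => ?_)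
  by_cases h : ξ ∈ freqBand (aconst ν μ) K
  · have hξ : 0 < |ξ| := by linarith [two_le_aconst ν μ, h.1]
    have e : |ξ| ^ α = |ξ| ^ (α + 1 / 4) * |ξ| ^ (-(1 / 4) : ℝ) := by
      rw [← Real.rpow_add hξ]; congr 1; ring
    have h' : aconst ν μ ≤ |ξ| ∧ |ξ| < K := h
    dsimp only
    rw [Set.indicator_of_mem h, truncKernel, if_pos h', e]
    push_cast; ring
  · have h' : ¬(aconst ν μ ≤ |ξ| ∧ |ξ| < K) := h
    dsimp only
    rw [Set.indicator_of_notMem h, truncKernel, if_neg h']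
    simp

lemma four_mul_le_of_rpow_le {β lam M y : ℝ} (hβ : 0 < β) (hM : 0 < M) (hlam : 0 < lam)
    (h : (lam / (4 * M)) ^ (1 / β) ≤ y) : lam ≤ 4 * M * y ^ β := by
  have h0 : 0 < lam / (4 * M) := by positivity
  have h1 := Real.rpow_le_rpow (by positivity) h hβ.le
  rw [← Real.rpow_mul h0.le, one_div_mul_cancel hβ.ne', Real.rpow_one] at h1
  rw [div_le_iff₀ (by positivity)] at h1
  linarith

/-- Distributional estimate combining smoothing for high frequencies and the maximal function for
low frequencies. -/
lemma volume_lt_norm_derivWave_le {ν μ α : ℝ} (hμ : μ ≠ 0) (hα : 0 < α + 1 / 4) {g : ℝ → ℂ}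
    (hgm : Measurable g) (hgi : Integrable g)
    (hg : IntegrableOn (fun ξ => ((|ξ| ^ α : ℝ) : ℂ) * g ξ) {ξ | aconst ν μ ≤ |ξ|}) {x M : ℝ}
    (hM : 0 < M) (hMt : ∀ t s, ‖truncWave ν μ g x t s‖ ≤ M) {lam : ℝ} (hlam : 0 < lam) :
    volume {t | lam < ‖derivWave ν μ α g x t‖} ≤
      (ENNReal.ofReal (4 * π / (3 * |μ|)) * ∫⁻ ξ, if aconst ν μ ≤ |ξ| ∧
        lam ≤ 4 * M * |ξ| ^ (α + 1 / 4) then ENNReal.ofReal (|ξ| ^ (2 * α - 2)) * ‖g ξ‖ₑ ^ 2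
        else 0) / ENNReal.ofReal ((lam / 2) ^ 2) := by
  set β := α + 1 / 4 with hβ
  set K := (lam / (4 * M)) ^ (1 / β) with hK
  have hK0 : 0 ≤ K := by positivity
  have hKβ : K ^ β = lam / (4 * M) := by
    rw [hK, ← Real.rpow_mul (by positivity), one_div_mul_cancel hα.ne', Real.rpow_one]
  set S := {ξ : ℝ | aconst ν μ ≤ |ξ| ∧ K ≤ |ξ|} with hS
  have hSm : MeasurableSet S :=
    (measurableSet_aconst_le ν μ).inter (measurableSet_le measurable_const measurable_norm)
  have hSE : S ⊆ {ξ : ℝ | aconst ν μ ≤ |ξ|} := fun ξ hξ => hξ.1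
  set high : ℝ → ℂ := fun t =>
    ∫ ξ in S, ((|ξ| ^ α : ℝ) : ℂ) * planeWave ν μ x t ξ * g ξ with hhigh
  have hsub : {t | lam < ‖derivWave ν μ α g x t‖} ⊆
      {t | ENNReal.ofReal ((lam / 2) ^ 2) ≤ ‖high t‖ₑ ^ 2} := by
    intro t ht
    simp only [Set.mem_ofPred_eq] at ht ⊢
    have h1 := norm_integral_rpow_mul_truncKernel_le (ν := ν) (μ := μ) hα hK0 hgm hgi
      (x := x) (t := t) (hMt t)
    rw [derivWave_eq_low_add_high hgm hg K x t] at ht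
    have h2 := norm_add_le (∫ ξ, ((|ξ| ^ β : ℝ) : ℂ) * (truncKernel ν μ x t K ξ * g ξ)) (high t)
    have h3 : 2 * (K ^ β * M) = lam / 2 := by rw [hKβ]; field_simp; norm_num
    rw [← ofReal_norm, ← ENNReal.ofReal_pow (norm_nonneg _)]
    refine ENNReal.ofReal_le_ofReal (pow_le_pow_left₀ (by positivity) ?_ 2)
    linarith
  refine (measure_mono hsub).trans ?_
  refine (meas_ge_le_lintegral_div
    ((measurable_setIntegral_wave hgm x S).enorm.pow_const 2).aemeasurable
    (by simpa using hlam.ne') ENNReal.ofReal_ne_top).trans ?_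
  gcongr
  refine (lintegral_smoothing_le hμ α hSm (fun ξ hξ => hξ.1) hgm (hg.mono_set hSE) x).trans
    (mul_le_mul_right ?_ _)
  rw [← lintegral_indicator hSm]
  refine lintegral_mono fun ξ => ?_
  by_cases h : ξ ∈ S
  · rw [Set.indicator_of_mem h, if_pos ⟨h.1, four_mul_le_of_rpow_le hα hM hlam h.2⟩]
  · rw [Set.indicator_of_notMem h]; exact zero_le

lemma lintegral_Ioc_rpow {q L : ℝ} (hq : 2 < q) (hL : 0 ≤ L) :
    ∫⁻ l in Set.Ioc 0 L, ENNReal.ofReal (4 * l ^ (q - 3)) =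
      ENNReal.ofReal (4 * (L ^ (q - 2) / (q - 2))) := by
  have hi : IntegrableOn (fun l : ℝ => 4 * l ^ (q - 3)) (Set.Ioc 0 L) :=
    (intervalIntegrable_iff_integrableOn_Ioc_of_le hL).1
      ((intervalIntegral.intervalIntegrable_rpow' (by linarith)).const_mul 4)
  rw [← ofReal_integral_eq_lintegral_ofReal hi
    ((ae_restrict_iff' measurableSet_Ioc).2 (Filter.Eventually.of_forall fun l hl => ?_))]
  · rw [← intervalIntegral.integral_of_le hL, intervalIntegral.integral_const_mul,
      integral_rpow (Or.inl (by linarith)), show q - 3 + 1 = q - 2 by ring,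
      Real.zero_rpow (by linarith), sub_zero]
  · have : 0 < l := hl.1
    simp only [Pi.zero_apply]; positivity

/-- Layer cake estimate at a fixed point for any bound `M` of the maximal function. -/
lemma lintegral_norm_derivWave_rpow_le {ν μ α q : ℝ} (hμ : μ ≠ 0) (hα : 0 < α + 1 / 4)
    (hq : 2 < q) (hqα : (α + 1 / 4) * (q - 2) = 2 - 2 * α) {g : ℝ → ℂ}
    (hgm : Measurable g) (hgi : Integrable g)
    (hg : IntegrableOn (fun ξ => ((|ξ| ^ α : ℝ) : ℂ) * g ξ) {ξ | aconst ν μ ≤ |ξ|}) {x M : ℝ}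
    (hM : 0 < M) (hMt : ∀ t s, ‖truncWave ν μ g x t s‖ ≤ M) :
    ∫⁻ t, ‖derivWave ν μ α g x t‖ₑ ^ q ≤
      ENNReal.ofReal (q * (4 * π / (3 * |μ|)) * (4 * ((4 * M) ^ (q - 2) / (q - 2)))) *
        ∫⁻ ξ, ‖g ξ‖ₑ ^ 2 := by
  have hm : 0 < |μ| := abs_pos.2 hμ
  set D := 4 * π / (3 * |μ|) with hD
  have hD0 : 0 ≤ D := by positivity
  set β := α + 1 / 4 with hβ
  have hfm : Measurable fun t => derivWave ν μ α g x t := measurable_setIntegral_wave hgm x _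
  have e0 : ∫⁻ t, ‖derivWave ν μ α g x t‖ₑ ^ q =
      ∫⁻ t, ENNReal.ofReal (‖derivWave ν μ α g x t‖ ^ q) := by
    refine lintegral_congr fun t => ?_
    rw [← ofReal_norm, ENNReal.ofReal_rpow_of_nonneg (norm_nonneg _) (by linarith)]
  rw [e0, lintegral_rpow_eq_lintegral_meas_lt_mul volume
    (Filter.Eventually.of_forall fun t => norm_nonneg _) hfm.norm.aemeasurable (by linarith)]
  set W : ℝ → ℝ≥0∞ := fun ξ => ENNReal.ofReal (|ξ| ^ (2 * α - 2)) * ‖g ξ‖ₑ ^ 2 with hW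
  have hWm : Measurable W :=
    (measurable_norm.pow_const _).ennreal_ofReal.mul (hgm.enorm.pow_const 2)
  set A : ℝ → ℝ → ℝ≥0∞ := fun l ξ =>
    if aconst ν μ ≤ |ξ| ∧ l ≤ 4 * M * |ξ| ^ β then W ξ * ENNReal.ofReal (4 * l ^ (q - 3)) else 0
    with hA
  have hAm : Measurable (Function.uncurry A) := by
    refine Measurable.ite ?_ ?_ measurable_const
    · exact (measurable_snd (measurableSet_aconst_le ν μ)).inter
        (measurableSet_le measurable_fst
          ((measurable_snd.norm.pow_const β).const_mul (4 * M)))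
    · exact (hWm.comp measurable_snd).mul
        ((measurable_fst.pow_const (q - 3)).const_mul 4).ennreal_ofReal
  have step : ∀ l : ℝ, 0 < l → volume {t | l < ‖derivWave ν μ α g x t‖} *
      ENNReal.ofReal (l ^ (q - 1)) ≤ ENNReal.ofReal D * ∫⁻ ξ, A l ξ := by
    intro l hl
    have h1 := volume_lt_norm_derivWave_le hμ hα hgm hgi hg hM hMt hl
    have h2 : ENNReal.ofReal (l ^ (q - 1)) =
        ENNReal.ofReal ((l / 2) ^ 2) * ENNReal.ofReal (4 * l ^ (q - 3)) := by
      rw [← ENNReal.ofReal_mul (by positivity)]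
      congr 1
      rw [show q - 1 = (q - 3) + (2 : ℕ) by push_cast; ring, Real.rpow_add hl, Real.rpow_natCast]
      ring
    have h0 : ENNReal.ofReal ((l / 2) ^ 2) ≠ 0 := by simpa using hl.ne'
    rw [h2]
    refine (mul_le_mul_left h1 _).trans_eq ?_
    rw [← mul_assoc, ENNReal.div_mul_cancel h0 ENNReal.ofReal_ne_top, mul_assoc,
      ← lintegral_mul_const' _ _ ENNReal.ofReal_ne_top]
    congr 1
    refine lintegral_congr fun ξ => ?_
    simp only [hA, ite_mul, zero_mul, hW, hβ]
  have inner : ∀ ξ, ∫⁻ l in Set.Ioi (0 : ℝ), A l ξ ≤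
      ENNReal.ofReal (4 * ((4 * M) ^ (q - 2) / (q - 2))) * ‖g ξ‖ₑ ^ 2 := by
    intro ξ
    by_cases hξ : aconst ν μ ≤ |ξ|
    swap
    · simp [hA, hξ]
    have h0 : 0 < |ξ| := by linarith [two_le_aconst ν μ]
    have hL : 0 ≤ 4 * M * |ξ| ^ β := by positivity
    have e : ∀ l, A l ξ = (Set.Iic (4 * M * |ξ| ^ β)).indicator
        (fun l => W ξ * ENNReal.ofReal (4 * l ^ (q - 3))) l := fun l => by
      simp only [hA, hξ, true_and, Set.indicator_apply, Set.mem_Iic]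
    simp only [e]
    rw [setLIntegral_indicator measurableSet_Iic, Set.inter_comm, Set.Ioi_inter_Iic,
      lintegral_const_mul _ (by fun_prop), lintegral_Ioc_rpow hq hL]
    simp only [hW]
    rw [mul_right_comm, ← ENNReal.ofReal_mul (by positivity)]
    refine le_of_eq ?_
    congr 2
    rw [Real.mul_rpow (by positivity) (by positivity), ← Real.rpow_mul h0.le, hqα]
    have : |ξ| ^ (2 * α - 2) * |ξ| ^ (2 - 2 * α) = 1 := by
      rw [← Real.rpow_add h0]; norm_num
    linear_combination (4 * ((4 * M) ^ (q - 2) / (q - 2))) * this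
  calc _ ≤ ENNReal.ofReal q * ∫⁻ l in Set.Ioi (0 : ℝ), ENNReal.ofReal D * ∫⁻ ξ, A l ξ := by
        exact mul_le_mul_right (setLIntegral_mono' measurableSet_Ioi fun l hl => step l hl) _
    _ = ENNReal.ofReal q * (ENNReal.ofReal D * ∫⁻ ξ, ∫⁻ l in Set.Ioi (0 : ℝ), A l ξ) := by
        rw [lintegral_const_mul' _ _ ENNReal.ofReal_ne_top, lintegral_lintegral_swap]
        exact hAm.aemeasurable
    _ ≤ ENNReal.ofReal q * (ENNReal.ofReal D * ∫⁻ ξ,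
          ENNReal.ofReal (4 * ((4 * M) ^ (q - 2) / (q - 2))) * ‖g ξ‖ₑ ^ 2) := by
        gcongr with ξ
        exact inner ξ
    _ = _ := by
        rw [lintegral_const_mul' _ _ ENNReal.ofReal_ne_top, ← mul_assoc, ← mul_assoc,
          ← ENNReal.ofReal_mul (by linarith), ← ENNReal.ofReal_mul (by positivity)]

/-- Pointwise interpolation between smoothing and the maximal function. -/
lemma lintegral_derivWave_rpow_le_maxWave {ν μ α q : ℝ} (hμ : μ ≠ 0) (hα : 0 < α + 1 / 4)
    (hq : 2 < q) (hqα : (α + 1 / 4) * (q - 2) = 2 - 2 * α) {g : ℝ → ℂ}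
    (hgm : Measurable g) (hgi : Integrable g)
    (hg : IntegrableOn (fun ξ => ((|ξ| ^ α : ℝ) : ℂ) * g ξ) {ξ | aconst ν μ ≤ |ξ|})
    (hg2 : ∫⁻ ξ, ‖g ξ‖ₑ ^ 2 ≠ ∞) (x : ℝ) :
    ∫⁻ t, ‖derivWave ν μ α g x t‖ₑ ^ q ≤
      ENNReal.ofReal (q * (4 * π / (3 * |μ|)) * (4 * (4 ^ (q - 2) / (q - 2)))) *
        (maxWave ν μ g x ^ (q - 2) * ∫⁻ ξ, ‖g ξ‖ₑ ^ 2) := by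
  have hm : 0 < |μ| := abs_pos.2 hμ
  set M := (maxWave ν μ g x).toReal with hM
  have hM0 : 0 ≤ M := ENNReal.toReal_nonneg
  have hMt : ∀ t s, ‖truncWave ν μ g x t s‖ ≤ M := fun t s => by
    rw [← toReal_enorm]
    exact ENNReal.toReal_mono (maxWave_ne_top hgi x) (enorm_truncWave_le_maxWave hgm hgi x t s)
  set c := q * (4 * π / (3 * |μ|)) * (4 * (4 ^ (q - 2) / (q - 2))) with hc
  have hc0 : 0 ≤ c := by have : 0 < q - 2 := by linarith
                         positivity
  have bound : ∀ M' ∈ Set.Ioi M, ∫⁻ t, ‖derivWave ν μ α g x t‖ₑ ^ q ≤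
      ENNReal.ofReal (c * M' ^ (q - 2)) * ∫⁻ ξ, ‖g ξ‖ₑ ^ 2 := by
    intro M' hM'
    have h0 : 0 < M' := hM0.trans_lt hM'
    refine (lintegral_norm_derivWave_rpow_le hμ hα hq hqα hgm hgi hg h0
      fun t s => (hMt t s).trans hM'.le).trans_eq ?_
    congr 2
    rw [Real.mul_rpow (by norm_num) h0.le, hc]; ring
  have lim : Filter.Tendsto (fun M' => ENNReal.ofReal (c * M' ^ (q - 2)) * ∫⁻ ξ, ‖g ξ‖ₑ ^ 2)
      (nhdsWithin M (Set.Ioi M))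
      (nhds (ENNReal.ofReal (c * M ^ (q - 2)) * ∫⁻ ξ, ‖g ξ‖ₑ ^ 2)) := by
    refine ENNReal.Tendsto.mul_const ?_ (Or.inr hg2)
    refine ((ENNReal.continuous_ofReal.comp (continuous_const.mul
      (Real.continuous_rpow_const (by linarith)))).tendsto M).mono_left nhdsWithin_le_nhds
  refine (ge_of_tendsto lim (eventually_nhdsWithin_of_forall bound)).trans_eq ?_
  rw [ENNReal.ofReal_mul hc0, ← ENNReal.ofReal_rpow_of_nonneg hM0 (by linarith), hM,
    ENNReal.ofReal_toReal (maxWave_ne_top hgi x), mul_assoc]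

lemma mixedLpLq_mono {p q : ℝ≥0∞} {f h : ℝ → ℝ → ℂ} (hfh : ∀ x t, ‖f x t‖ ≤ ‖h x t‖) :
    mixedLpLq p q f ≤ mixedLpLq p q h := by
  have e : ∀ x, eLpNorm (f x) q volume ≤ eLpNorm (h x) q volume := fun x =>
    eLpNorm_mono (hfh x)
  unfold mixedLpLq
  split_ifs
  · exact essSup_mono_ae (Filter.Eventually.of_forall e)
  · gcongr with x
    exact e x

/-- At `α = -1/4` the solution is bounded by the maximal function. -/
lemma enorm_derivWave_neg_quarter_le {ν μ : ℝ} {g : ℝ → ℂ} (hgm : Measurable g)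
    (hgi : Integrable g) (x t : ℝ) :
    ‖derivWave ν μ (-(1 / 4)) g x t‖ₑ ≤ maxWave ν μ g x := by
  have hlim : Filter.Tendsto (fun n : ℕ => truncWave ν μ g x t n) Filter.atTop
      (nhds (derivWave ν μ (-(1 / 4)) g x t)) := by
    rw [derivWave, ← integral_indicator (measurableSet_aconst_le ν μ)]
    refine tendsto_integral_of_dominated_convergence (fun ξ => ‖g ξ‖) (fun n => ?_) hgi.norm
      (fun n => Filter.Eventually.of_forall fun ξ => ?_)
      (Filter.Eventually.of_forall fun ξ => ?_)
    · exact ((measurable_truncKernel measurable_const measurable_const measurable_const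
        measurable_id).mul hgm).aestronglyMeasurable
    · rw [norm_mul]
      exact (mul_le_mul_of_nonneg_right (norm_truncKernel_le_one _ _ _ _ _ _)
        (norm_nonneg _)).trans_eq (one_mul _)
    · refine tendsto_const_nhds.congr' ?_
      obtain ⟨N, hN⟩ := exists_nat_gt |ξ|
      filter_upwards [Filter.eventually_ge_atTop N] with n hn
      have h : |ξ| < (n : ℝ) := hN.trans_le (by exact_mod_cast hn)
      rw [Set.indicator_apply]
      simp only [truncKernel, h, and_true, Set.mem_ofPred_eq, ite_mul, zero_mul]
  exact le_of_tendsto' (continuous_enorm.continuousAt.tendsto.comp hlim)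
    fun n => enorm_truncWave_le_maxWave hgm hgi x t n

lemma lintegral_maxWave_rpow_le {ν μ : ℝ} (hμ : μ ≠ 0) {g : ℝ → ℂ} (hgm : Measurable g)
    (hgi : Integrable g) :
    ∫⁻ x, maxWave ν μ g x ^ (4 : ℝ) ≤ (720 * ∫⁻ ξ, ‖g ξ‖ₑ ^ 2) ^ (2 : ℝ) := by
  have h := lintegral_maxWave_le (ν := ν) hμ hgm hgi
  have e4 : ∀ y : ℝ≥0∞, y ^ (4 : ℝ) = y ^ 4 := fun y => by
    rw [← ENNReal.rpow_natCast]; norm_num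
  have e2 : ∀ y : ℝ≥0∞, y ^ (2 : ℝ) = y ^ 2 := fun y => by
    rw [← ENNReal.rpow_natCast]; norm_num
  simpa only [e4, e2] using h

/-- The estimate in terms of the Fourier transform of the data. -/
lemma exists_mixedLpLq_derivWave_le {ν μ : ℝ} (hμ : μ ≠ 0) {α : ℝ}
    (hα : α ∈ Set.Icc (-(1 / 4) : ℝ) 1) :
    ∃ C : ℝ≥0∞, C ≠ ∞ ∧ ∀ g : ℝ → ℂ, Measurable g → Integrable g →
      IntegrableOn (fun ξ => ((|ξ| ^ α : ℝ) : ℂ) * g ξ) {ξ | aconst ν μ ≤ |ξ|} →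
      ∫⁻ ξ, ‖g ξ‖ₑ ^ 2 ≠ ∞ →
      mixedLpLq (ENNReal.ofReal ((1 - α) / 5))⁻¹ (ENNReal.ofReal ((4 * α + 1) / 10))⁻¹
        (derivWave ν μ α g) ≤ C * (∫⁻ ξ, ‖g ξ‖ₑ ^ 2) ^ (1 / 2 : ℝ) := by
  obtain ⟨hα0, hα1⟩ := hα
  rcases hα1.eq_or_lt with rfl | hα1
  · refine ⟨ENNReal.ofReal (4 * π / (3 * |μ|)) ^ (1 / 2 : ℝ),
      ENNReal.rpow_ne_top_of_nonneg (by norm_num) ENNReal.ofReal_ne_top,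
      fun g hgm hgi hg hg2 => ?_⟩
    have hp : (ENNReal.ofReal ((1 - 1) / 5))⁻¹ = ∞ := by simp
    have hq : (ENNReal.ofReal ((4 * 1 + 1) / 10))⁻¹ = 2 := by
      rw [show ((4 * 1 + 1) / 10 : ℝ) = 2⁻¹ by norm_num, ENNReal.ofReal_inv_of_pos (by norm_num)]
      simp
    rw [hp, hq, mixedLpLq, if_pos rfl]
    refine essSup_le_of_ae_le _ (Filter.Eventually.of_forall fun x => ?_)
    dsimp only
    rw [eLpNorm_eq_lintegral_rpow_enorm_toReal (by norm_num) (by norm_num),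
      ← ENNReal.mul_rpow_of_nonneg _ _ (by norm_num)]
    simp only [ENNReal.toReal_ofNat, ENNReal.rpow_ofNat]
    gcongr
    refine (lintegral_smoothing_le hμ 1 (measurableSet_aconst_le ν μ) (fun ξ hξ => hξ)
      hgm hg x).trans (mul_le_mul_right ?_ _)
    refine (setLIntegral_le_lintegral _ _).trans (lintegral_mono fun ξ => ?_)
    norm_num
  rcases hα0.eq_or_lt with rfl | hα0
  · refine ⟨720 ^ (1 / 2 : ℝ), ENNReal.rpow_ne_top_of_nonneg (by norm_num) (by norm_num),
      fun g hgm hgi hg hg2 => ?_⟩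
    have hp : (ENNReal.ofReal ((1 - -(1 / 4)) / 5))⁻¹ = 4 := by
      rw [show ((1 - -(1 / 4)) / 5 : ℝ) = 4⁻¹ by norm_num,
        ENNReal.ofReal_inv_of_pos (by norm_num)]
      simp
    have hq : (ENNReal.ofReal ((4 * -(1 / 4) + 1) / 10))⁻¹ = ∞ := by norm_num
    rw [hp, hq, mixedLpLq, if_neg (by norm_num), ← ENNReal.mul_rpow_of_nonneg _ _ (by norm_num)]
    simp only [ENNReal.toReal_ofNat]
    calc _ ≤ ((720 * ∫⁻ ξ, ‖g ξ‖ₑ ^ 2) ^ (2 : ℝ)) ^ (1 / 4 : ℝ) := by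
          gcongr
          refine le_trans (lintegral_mono fun x => ?_)
            (lintegral_maxWave_rpow_le (ν := ν) hμ hgm hgi)
          gcongr
          rw [eLpNorm_exponent_top]
          exact eLpNormEssSup_le_of_ae_enorm_bound
            (Filter.Eventually.of_forall fun t => enorm_derivWave_neg_quarter_le hgm hgi x t)
      _ = _ := by rw [← ENNReal.rpow_mul]; norm_num
  set q : ℝ := 10 / (4 * α + 1) with hq
  set p : ℝ := 5 / (1 - α) with hp
  have h1 : 0 < 4 * α + 1 := by linarith
  have h2 : 0 < 1 - α := by linarith
  have hp0 : 0 < p := by positivity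
  have hq0 : 0 < q := by positivity
  have hq2 : 2 < q := by rw [hq, lt_div_iff₀ h1]; linarith
  have hqα : (α + 1 / 4) * (q - 2) = 2 - 2 * α := by
    have : q * (4 * α + 1) = 10 := div_mul_cancel₀ _ h1.ne'
    linear_combination (1 / 4) * this
  have hpE : (ENNReal.ofReal ((1 - α) / 5))⁻¹ = ENNReal.ofReal p := by
    rw [← ENNReal.ofReal_inv_of_pos (by positivity), hp, inv_div]
  have hqE : (ENNReal.ofReal ((4 * α + 1) / 10))⁻¹ = ENNReal.ofReal q := by
    rw [← ENNReal.ofReal_inv_of_pos (by positivity), hq, inv_div]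
  set c := ENNReal.ofReal (q * (4 * π / (3 * |μ|)) * (4 * (4 ^ (q - 2) / (q - 2)))) with hc
  refine ⟨c ^ (1 / q) * 720 ^ (2 / p), ENNReal.mul_ne_top
    (ENNReal.rpow_ne_top_of_nonneg (by positivity) ENNReal.ofReal_ne_top)
    (ENNReal.rpow_ne_top_of_nonneg (by positivity) (by norm_num)), fun g hgm hgi hg hg2 => ?_⟩
  rw [hpE, hqE, mixedLpLq, if_neg ENNReal.ofReal_ne_top, ENNReal.toReal_ofReal hp0.le]
  set N := ∫⁻ ξ, ‖g ξ‖ₑ ^ 2 with hN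
  have pointwise : ∀ x, eLpNorm (derivWave ν μ α g x) (ENNReal.ofReal q) volume ^ p ≤
      (c * N) ^ (p / q) * maxWave ν μ g x ^ (4 : ℝ) := by
    intro x
    rw [eLpNorm_eq_lintegral_rpow_enorm_toReal (by simpa using hq0) ENNReal.ofReal_ne_top,
      ENNReal.toReal_ofReal hq0.le, ← ENNReal.rpow_mul]
    have e : 1 / q * p = p / q := by ring
    rw [e]
    calc _ ≤ (c * (maxWave ν μ g x ^ (q - 2) * N)) ^ (p / q) := by
          gcongr
          exact lintegral_derivWave_rpow_le_maxWave hμ (by linarith) hq2 hqα hgm hgi hg hg2 x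
      _ = (c * N) ^ (p / q) * (maxWave ν μ g x ^ (q - 2)) ^ (p / q) := by
          rw [← ENNReal.mul_rpow_of_nonneg _ _ (by positivity)]; congr 1; ring
      _ = _ := by
          rw [← ENNReal.rpow_mul]; congr 2
          rw [hq, hp]; field_simp; ring
  have hpq : 1 / q + 2 / p = 1 / 2 := by rw [hq, hp]; field_simp; ring
  calc _ ≤ ((c * N) ^ (p / q) * (720 * N) ^ (2 : ℝ)) ^ (1 / p) := by
        gcongr
        refine (lintegral_mono pointwise).trans ?_
        rw [lintegral_const_mul' _ _ (ENNReal.rpow_ne_top_of_nonneg (by positivity)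
          (ENNReal.mul_ne_top ENNReal.ofReal_ne_top hg2))]
        gcongr
        exact lintegral_maxWave_rpow_le hμ hgm hgi
    _ = (c * N) ^ (1 / q) * (720 * N) ^ (2 / p) := by
        rw [ENNReal.mul_rpow_of_nonneg _ _ (by positivity), ← ENNReal.rpow_mul, ← ENNReal.rpow_mul]
        congr 2 <;> field_simp
    _ = c ^ (1 / q) * 720 ^ (2 / p) * (N ^ (1 / q) * N ^ (2 / p)) := by
        rw [ENNReal.mul_rpow_of_nonneg _ _ (by positivity),
          ENNReal.mul_rpow_of_nonneg _ _ (by positivity)]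
        ring
    _ = _ := by rw [← ENNReal.rpow_add_of_nonneg _ _ (by positivity) (by positivity), hpq]

lemma FT_eq_fourier (u : SchwartzMap ℝ ℂ) (ξ : ℝ) :
    FT (fun x => u x) ξ = FourierTransform.fourier u ((2 * π)⁻¹ * ξ) := by
  rw [SchwartzMap.fourier_coe, Real.fourier_real_eq_integral_exp_smul, FT]
  refine integral_congr_ae (Filter.Eventually.of_forall fun x => ?_)
  simp only [smul_eq_mul]
  congr 2
  rw [show -2 * π * x * ((2 * π)⁻¹ * ξ) = -(ξ * x) by field_simp]
  push_cast; ring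

lemma continuous_FT (u : SchwartzMap ℝ ℂ) : Continuous (FT fun x => u x) := by
  have e : (FT fun x => u x) = fun ξ => FourierTransform.fourier u ((2 * π)⁻¹ * ξ) :=
    funext (FT_eq_fourier u)
  rw [e]
  exact (SchwartzMap.continuous _).comp (continuous_const.mul continuous_id)

lemma integrable_abs_pow_mul_norm_FT (u : SchwartzMap ℝ ℂ) (k : ℕ) :
    Integrable fun ξ => |ξ| ^ k * ‖FT (fun x => u x) ξ‖ := by
  have h := ((SchwartzMap.integrable_pow_mul volume (FourierTransform.fourier u) k).comp_mul_left'
    (R := (2 * π)⁻¹) (by positivity)).const_mul ((2 * π) ^ k)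
  refine h.congr (Filter.Eventually.of_forall fun ξ => ?_)
  simp only [FT_eq_fourier, norm_mul, mul_pow, Real.norm_eq_abs]
  rw [abs_of_nonneg (by positivity : 0 ≤ (2 * π)⁻¹)]
  have : (2 * π) ^ k * ((2 * π)⁻¹) ^ k = 1 := by
    rw [← mul_pow, mul_inv_cancel₀ (by positivity), one_pow]
  rw [mul_pow] at this
  rw [← mul_assoc, ← mul_assoc, this, one_mul]

lemma lintegral_FT_sq (u : SchwartzMap ℝ ℂ) :
    ∫⁻ ξ, ‖FT (fun x => u x) ξ‖ₑ ^ 2 = ENNReal.ofReal (2 * π) * ∫⁻ x, ‖u x‖ₑ ^ 2 := by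
  have key : ∀ f : SchwartzMap ℝ ℂ, ∫⁻ x, ‖f x‖ₑ ^ 2 = ENNReal.ofReal (∫ x, ‖f x‖ ^ 2) := by
    intro f
    have hi : Integrable fun x => ‖f x‖ ^ 2 := (f.memLp 2 volume).integrable_norm_pow (by norm_num)
    rw [ofReal_integral_eq_lintegral_ofReal hi
      (Filter.Eventually.of_forall fun x => by positivity)]
    refine lintegral_congr fun x => ?_
    rw [ENNReal.ofReal_pow (norm_nonneg _), ofReal_norm]
  set v := FourierTransform.fourier u with hv
  have hi : Integrable fun ξ => ‖v ((2 * π)⁻¹ * ξ)‖ ^ 2 :=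
    Integrable.comp_mul_left' (g := fun y => ‖v y‖ ^ 2)
      ((v.memLp 2 volume).integrable_norm_pow (by norm_num)) (by positivity)
  calc ∫⁻ ξ, ‖FT (fun x => u x) ξ‖ₑ ^ 2
      = ENNReal.ofReal (∫ ξ, ‖v ((2 * π)⁻¹ * ξ)‖ ^ 2) := by
        rw [ofReal_integral_eq_lintegral_ofReal hi
          (Filter.Eventually.of_forall fun x => by positivity)]
        refine lintegral_congr fun x => ?_
        rw [FT_eq_fourier, ENNReal.ofReal_pow (norm_nonneg _), ofReal_norm]
    _ = _ := by
        rw [Measure.integral_comp_inv_mul_left (fun y => ‖v y‖ ^ 2) (2 * π),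
          SchwartzMap.integral_norm_sq_fourier, smul_eq_mul, abs_of_nonneg (by positivity),
          ENNReal.ofReal_mul (by positivity), key u]

/-- **Lemma 2.1, estimate (2.4)** (interpolated smoothing–maximal estimates):
for every `α ∈ [-1/4, 1]` there is `C > 0`, depending only on `ν, μ, α`, such
that `‖D_x^α S(t) P^a u₀‖_{L^p_x L^q_t} ≤ C ‖u₀‖_{L²}` for all Schwartz `u₀`,
where `1/p = (1-α)/5` and `1/q = (4α+1)/10`. -/
theorem benjamin_interpolated_estimates (ν μ : ℝ) (hμ : μ ≠ 0) (α : ℝ)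
    (hα : α ∈ Set.Icc (-(1 / 4) : ℝ) 1) :
    ∃ C > (0 : ℝ), ∀ u₀ : SchwartzMap ℝ ℂ,
      mixedLpLq (ENNReal.ofReal ((1 - α) / 5))⁻¹ (ENNReal.ofReal ((4 * α + 1) / 10))⁻¹
          (DSgrpPa ν μ α (fun x => u₀ x)) ≤
        ENNReal.ofReal C * eLpNorm (fun x => u₀ x) 2 volume := by
  obtain ⟨C, hC, h⟩ := exists_mixedLpLq_derivWave_le (ν := ν) hμ hα
  refine ⟨C.toReal * √(2 * π) + 1, by positivity, fun u₀ => ?_⟩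
  set g := FT fun x => u₀ x with hg
  have hgm : Measurable g := (continuous_FT u₀).measurable
  have hgi : Integrable g := by
    have := integrable_abs_pow_mul_norm_FT u₀ 0
    simp only [pow_zero, one_mul] at this
    exact (integrable_norm_iff hgm.aestronglyMeasurable).1 this
  have hgα : IntegrableOn (fun ξ => ((|ξ| ^ α : ℝ) : ℂ) * g ξ) {ξ | aconst ν μ ≤ |ξ|} := by
    refine Integrable.mono' (integrable_abs_pow_mul_norm_FT u₀ 1).integrableOn
      ((Complex.measurable_ofReal.comp (measurable_norm.pow_const α)).mul hgm).aestronglyMeasurable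
      ((ae_restrict_iff' (measurableSet_aconst_le ν μ)).2
        (Filter.Eventually.of_forall fun ξ hξ => ?_))
    have h1 : 1 ≤ |ξ| := by
      have : aconst ν μ ≤ |ξ| := hξ
      linarith [two_le_aconst ν μ]
    rw [norm_mul, Complex.norm_real, Real.norm_eq_abs, abs_of_nonneg (by positivity : 0 ≤ |ξ| ^ α)]
    gcongr
    rw [← Real.rpow_natCast]
    exact Real.rpow_le_rpow_of_exponent_le h1 (by simpa using hα.2)
  have hE : eLpNorm (fun x => u₀ x) 2 volume = (∫⁻ x, ‖u₀ x‖ₑ ^ 2) ^ (1 / 2 : ℝ) := by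
    rw [eLpNorm_eq_lintegral_rpow_enorm_toReal (by norm_num) (by norm_num)]
    simp only [ENNReal.toReal_ofNat, ENNReal.rpow_ofNat]
  have hEtop : eLpNorm (fun x => u₀ x) 2 volume ≠ ∞ := (u₀.memLp 2 volume).2.ne
  have hN : (∫⁻ ξ, ‖g ξ‖ₑ ^ 2) ^ (1 / 2 : ℝ) =
      ENNReal.ofReal √(2 * π) * eLpNorm (fun x => u₀ x) 2 volume := by
    rw [lintegral_FT_sq, ENNReal.mul_rpow_of_nonneg _ _ (by norm_num), hE, Real.sqrt_eq_rpow,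
      ENNReal.ofReal_rpow_of_nonneg (by positivity) (by norm_num)]
  have hg2 : ∫⁻ ξ, ‖g ξ‖ₑ ^ 2 ≠ ∞ := by
    intro htop
    rw [htop, ENNReal.top_rpow_of_pos (by norm_num)] at hN
    exact ENNReal.mul_ne_top ENNReal.ofReal_ne_top hEtop hN.symm
  have hle : ∀ x t, ‖DSgrpPa ν μ α (fun x => u₀ x) x t‖ ≤ ‖derivWave ν μ α g x t‖ := by
    intro x t
    have e : DSgrpPa ν μ α (fun x => u₀ x) x t = (2 * π)⁻¹ • derivWave ν μ α g x t := by
      rw [DSgrpPa, derivWave, ← integral_indicator (measurableSet_aconst_le ν μ)]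
      rfl
    rw [e, norm_smul, Real.norm_eq_abs, abs_of_nonneg (by positivity)]
    refine mul_le_of_le_one_left (norm_nonneg _) (inv_le_one_of_one_le₀ ?_)
    linarith [Real.pi_gt_three]
  refine (mixedLpLq_mono hle).trans ((h g hgm hgi hgα hg2).trans ?_)
  rw [hN, ← mul_assoc]
  gcongr
  rw [ENNReal.ofReal_add (by positivity) (by norm_num), ENNReal.ofReal_mul (by positivity),
    ENNReal.ofReal_toReal hC]
  exact le_self_add
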